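/- arXiv:2507.10790 — 4 statements merged into one kernel-verified Lean document; each statement's English description precedes it below -/
import Mathlib

section
/- Let G be a finite group, H ≤ G a subgroup, and (π, W) an irreducible finite-dimensional complex representation of H. The map F ↦ f_F, where f_F(g) = (dim W)·tr(F(g)), is a ℂ-linear bijection from the Hecke algebra H̃(G,H,π) onto I_π(G) which reverses products: f_{F₁*F₂} = f_{F₂} * f_{F₁} for all F₁, F₂ ∈ H̃(G,H,π); its inverse is the map sending f ∈ I_π(G) to F_f, where F_f(x) = (1/|H|) Σ_{y ∈ H} f(yx)·π(y). -/
open CategoryTheory Module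

noncomputable section

/-- A function `F : G → End(W)` belongs to the Hecke algebra of `(G, H, π)` if
`F(h₁ g h₂) = π(h₂)⁻¹ ∘ F(g) ∘ π(h₁)⁻¹` for all `h₁, h₂ ∈ H` and `g ∈ G`. -/
def IsHecke {G : Type} [Group G] (H : Subgroup G) {W : Type} [AddCommGroup W] [Module ℂ W]
    (π : Representation ℂ H W) (F : G → (W →ₗ[ℂ] W)) : Prop :=
  ∀ (h₁ h₂ : H) (g : G), F (↑h₁ * g * ↑h₂) = (π h₂⁻¹) ∘ₗ F g ∘ₗ (π h₁⁻¹)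

/-- The convolution product `(F₁ * F₂)(x) = (1/|G|) Σ_y F₁(y⁻¹x) ∘ F₂(y)` on the Hecke
algebra. -/
def heckeConv {G : Type} [Group G] [Fintype G] {W : Type} [AddCommGroup W] [Module ℂ W]
    (F₁ F₂ : G → (W →ₗ[ℂ] W)) : G → (W →ₗ[ℂ] W) :=
  fun x => (Fintype.card G : ℂ)⁻¹ • ∑ y : G, (F₁ (y⁻¹ * x)) ∘ₗ (F₂ y)

/-- The convolution product `(f₁ * f₂)(x) = (1/|G|) Σ_y f₁(y) f₂(y⁻¹x)` on complex-valued
functions on `G`. -/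
def convC {G : Type} [Group G] [Fintype G] (f₁ f₂ : G → ℂ) : G → ℂ :=
  fun x => (Fintype.card G : ℂ)⁻¹ * ∑ y : G, f₁ y * f₂ (y⁻¹ * x)

/-- The idempotent `e_π : G → ℂ`, equal to `(|G|·dim W/|H|)·tr π(g⁻¹)` on `H` and `0`
outside of `H`. -/
def ePi {G : Type} [Group G] [Fintype G] (H : Subgroup G) [DecidablePred (· ∈ H)]
    {W : Type} [AddCommGroup W] [Module ℂ W] (π : Representation ℂ H W) (g : G) : ℂ :=
  if hg : g ∈ H then
    (Fintype.card G : ℂ) * (finrank ℂ W : ℂ) / (Nat.card H : ℂ) *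
      LinearMap.trace ℂ W (π (⟨g, hg⟩⁻¹ : H))
  else 0

/-- Membership in `I_π(G)`: `H`-conjugation invariance together with
`e_π * f = f = f * e_π`. -/
def MemIpi {G : Type} [Group G] [Fintype G] (H : Subgroup G) [DecidablePred (· ∈ H)]
    {W : Type} [AddCommGroup W] [Module ℂ W] (π : Representation ℂ H W) (f : G → ℂ) :
    Prop :=
  (∀ (h : H) (g : G), f (↑h * g * (↑h : G)⁻¹) = f g) ∧
    convC (ePi H π) f = f ∧ convC f (ePi H π) = f

/-- The map `F ↦ f_F`, `f_F(g) = (dim W)·tr(F(g))`. -/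
def heckeToFun {G : Type} [Group G] {W : Type} [AddCommGroup W] [Module ℂ W]
    (F : G → (W →ₗ[ℂ] W)) : G → ℂ :=
  fun g => (finrank ℂ W : ℂ) * LinearMap.trace ℂ W (F g)

/-- The map `f ↦ F_f`, `F_f(x) = (1/|H|) Σ_{y ∈ H} f(yx)·π(y)`. -/
def funToHecke {G : Type} [Group G] (H : Subgroup G) [Fintype H]
    {W : Type} [AddCommGroup W] [Module ℂ W] (π : Representation ℂ H W) (f : G → ℂ) :
    G → (W →ₗ[ℂ] W) :=
  fun x => (Nat.card H : ℂ)⁻¹ • ∑ y : H, f (↑y * x) • π y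

section Schur

variable {H W : Type} [Group H] [Fintype H] [AddCommGroup W] [Module ℂ W]
  [FiniteDimensional ℂ W]

/-- The conjugation average of an endomorphism is the scalar determined by its trace. -/
theorem finrank_smul_sum_conj (π : Representation ℂ H W)
    (hπ : ∀ T : End ℂ W, (∀ h, T * π h = π h * T) → ∃ c : ℂ, T = c • 1) (A : End ℂ W) :
    (finrank ℂ W : ℂ) • ∑ h : H, π h * A * π h⁻¹ =
      ((Nat.card H : ℂ) * LinearMap.trace ℂ W A) • 1 := by
  obtain ⟨c, hc⟩ := hπ (∑ h : H, π h * A * π h⁻¹) fun g => by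
    rw [Finset.sum_mul, Finset.mul_sum]
    refine Fintype.sum_equiv (Equiv.mulLeft g⁻¹) _ _ fun h => ?_
    simp [mul_assoc, ← map_mul]
    simp [← mul_assoc, ← map_mul]
  have htr : c * finrank ℂ W = Nat.card H * LinearMap.trace ℂ W A := by
    have h := congrArg (LinearMap.trace ℂ W) hc
    have hconj (g : H) : LinearMap.trace ℂ W (π g * A * π g⁻¹) = LinearMap.trace ℂ W A := by
      rw [LinearMap.trace_mul_comm, ← mul_assoc, ← map_mul]
      simp
    simpa [hconj] using h.symm
  rw [hc, smul_smul, mul_comm, htr]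

/-- Fourier inversion on `End W`: an endomorphism is recovered from the traces of its products
with the operators of the representation. -/
theorem finrank_smul_sum_trace_smul (π : Representation ℂ H W)
    (hπ : ∀ T : End ℂ W, (∀ h, T * π h = π h * T) → ∃ c : ℂ, T = c • 1) (A : End ℂ W) :
    (finrank ℂ W : ℂ) • ∑ h : H, LinearMap.trace ℂ W (A * π h⁻¹) • π h =
      (Nat.card H : ℂ) • A := by
  ext w
  let b := finBasis ℂ W
  have hb (i) : (finrank ℂ W : ℂ) • ∑ h : H, b.coord i (A (π h⁻¹ (b i))) • π h w =
      ((Nat.card H : ℂ) * b.coord i (A w)) • b i := by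
    have h := LinearMap.congr_fun
      (finrank_smul_sum_conj π hπ ((b.coord i ∘ₗ A).smulRight w)) (b i)
    simpa [LinearMap.trace_smulRight] using h
  have htr (T : End ℂ W) : LinearMap.trace ℂ W T = ∑ i, b.coord i (T (b i)) := by
    simp [LinearMap.trace_eq_matrix_trace ℂ b, Matrix.trace, LinearMap.toMatrix_apply]
  calc ((finrank ℂ W : ℂ) • ∑ h : H, LinearMap.trace ℂ W (A * π h⁻¹) • π h) w
      = ∑ i, (finrank ℂ W : ℂ) • ∑ h : H, b.coord i (A (π h⁻¹ (b i))) • π h w := by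
        simp only [htr, LinearMap.smul_apply, LinearMap.sum_apply, Finset.sum_smul,
          Module.End.mul_apply, ← Finset.smul_sum]
        rw [Finset.sum_comm]
    _ = (Nat.card H : ℂ) • A w := by
        rw [Finset.sum_congr rfl fun i _ => hb i]
        simp only [mul_smul, ← Finset.smul_sum, Basis.coord_apply, b.sum_repr]
    _ = ((Nat.card H : ℂ) • A) w := rfl

/-- Schur orthogonality for traces. -/
theorem finrank_mul_sum_trace_mul_trace (π : Representation ℂ H W)
    (hπ : ∀ T : End ℂ W, (∀ h, T * π h = π h * T) → ∃ c : ℂ, T = c • 1) (A B : End ℂ W) :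
    (finrank ℂ W : ℂ) *
        ∑ h : H, LinearMap.trace ℂ W (A * π h⁻¹) * LinearMap.trace ℂ W (B * π h) =
      Nat.card H * LinearMap.trace ℂ W (B * A) := by
  have h := congrArg (fun T => LinearMap.trace ℂ W (B * T)) (finrank_smul_sum_trace_smul π hπ A)
  simpa [Finset.mul_sum] using h

end Schur

section Hecke

variable {G : Type} [Group G] {H : Subgroup G} {W : Type} [AddCommGroup W] [Module ℂ W]
  {π : Representation ℂ H W}

theorem IsHecke.map_mul_left {F : G → (W →ₗ[ℂ] W)} (hF : IsHecke H π F) (h : H) (g : G) :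
    F (↑h * g) = F g * π h⁻¹ := by
  simpa [← Module.End.mul_eq_comp] using hF h 1 g

theorem IsHecke.map_mul_right {F : G → (W →ₗ[ℂ] W)} (hF : IsHecke H π F) (h : H) (g : G) :
    F (g * ↑h) = π h⁻¹ * F g := by
  simpa [← Module.End.mul_eq_comp] using hF 1 h g

theorem IsHecke.heckeToFun_conj {F : G → (W →ₗ[ℂ] W)} (hF : IsHecke H π F) (h : H) (g : G) :
    heckeToFun F (↑h * g * (↑h : G)⁻¹) = heckeToFun F g := by
  have h₁ := hF.map_mul_right h⁻¹ (↑h * g)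
  rw [hF.map_mul_left, inv_inv, Subgroup.coe_inv] at h₁
  simp only [heckeToFun]
  rw [h₁, LinearMap.trace_mul_comm, mul_assoc, ← map_mul]
  simp

theorem ePi_coe [Fintype G] [DecidablePred (· ∈ H)] (h : H) :
    ePi H π (h : G) = (Fintype.card G : ℂ) * (finrank ℂ W : ℂ) / (Nat.card H : ℂ) *
      LinearMap.trace ℂ W (π h⁻¹) := by
  simp [ePi]

theorem sum_ePi_mul [Fintype G] [Fintype H] [DecidablePred (· ∈ H)] (f : G → ℂ) :
    ∑ y : G, ePi H π y * f y = ∑ h : H, ePi H π (h : G) * f h := by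
  have h₀ (y : G) (hy : y ∉ H) : ePi H π y * f y = 0 := by simp [ePi, hy]
  rw [← Finset.sum_subset (Finset.subset_univ (Finset.univ.filter (· ∈ H)))
    fun y _ hy => h₀ y (by simpa using hy)]
  exact Finset.sum_subtype _ (by simp) _

theorem convC_ePi_left [Fintype G] [Fintype H] [DecidablePred (· ∈ H)] (f : G → ℂ) (x : G) :
    convC (ePi H π) f x = (finrank ℂ W : ℂ) * ((Nat.card H : ℂ)⁻¹ *
      ∑ h : H, f (↑h * x) * LinearMap.trace ℂ W (π h)) := by
  have hG : (Fintype.card G : ℂ) ≠ 0 := by simp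
  rw [convC, sum_ePi_mul fun y => f (y⁻¹ * x), Finset.mul_sum, Finset.mul_sum, Finset.mul_sum]
  refine Fintype.sum_equiv (Equiv.inv H) _ _ fun h => ?_
  rw [ePi_coe]
  simp only [Equiv.inv_apply, Subgroup.coe_inv]
  field_simp

theorem convC_ePi_right [Fintype G] [Fintype H] [DecidablePred (· ∈ H)] (f : G → ℂ) (x : G) :
    convC f (ePi H π) x = (finrank ℂ W : ℂ) * ((Nat.card H : ℂ)⁻¹ *
      ∑ h : H, f (x * ↑h) * LinearMap.trace ℂ W (π h)) := by
  have hG : (Fintype.card G : ℂ) ≠ 0 := by simp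
  have hsum : ∑ y : G, f y * ePi H π (y⁻¹ * x) = ∑ y : G, ePi H π y * f (x * y⁻¹) :=
    Fintype.sum_equiv ((Equiv.inv G).trans (Equiv.mulRight x)) _ _ fun y => by
      simp [mul_comm]
  rw [convC, hsum, sum_ePi_mul fun y => f (x * y⁻¹), Finset.mul_sum, Finset.mul_sum,
    Finset.mul_sum]
  refine Fintype.sum_equiv (Equiv.inv H) _ _ fun h => ?_
  rw [ePi_coe]
  simp only [Equiv.inv_apply, Subgroup.coe_inv]
  field_simp

theorem convC_ePi_comm [Fintype G] [Fintype H] [DecidablePred (· ∈ H)] {f : G → ℂ}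
    (hf : ∀ (h : H) (g : G), f (↑h * g * (↑h : G)⁻¹) = f g) :
    convC f (ePi H π) = convC (ePi H π) f := by
  ext x
  rw [convC_ePi_left, convC_ePi_right]
  refine congrArg _ (congrArg _ (Finset.sum_congr rfl fun h _ => ?_))
  rw [← hf h (x * h)]
  simp [mul_assoc]

theorem heckeToFun_funToHecke [Fintype G] [Fintype H] [DecidablePred (· ∈ H)] (f : G → ℂ) :
    heckeToFun (funToHecke H π f) = convC (ePi H π) f := by
  ext x
  simp [convC_ePi_left, heckeToFun, funToHecke]

theorem isHecke_funToHecke [Fintype H] {f : G → ℂ}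
    (hf : ∀ (h : H) (g : G), f (↑h * g * (↑h : G)⁻¹) = f g) :
    IsHecke H π (funToHecke H π f) := by
  intro h₁ h₂ g
  change _ = π h₂⁻¹ * (funToHecke H π f g * π h₁⁻¹)
  simp only [funToHecke, smul_mul_assoc, mul_smul_comm, Finset.sum_mul, Finset.mul_sum]
  refine congrArg _ (Fintype.sum_equiv ((Equiv.mulLeft h₂).trans (Equiv.mulRight h₁)) _ _
    fun y => ?_)
  rw [← hf h₂ (↑y * (↑h₁ * g * ↑h₂))]
  simp [mul_assoc, ← map_mul]

theorem IsHecke.funToHecke_heckeToFun [FiniteDimensional ℂ W] [Fintype H]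
    (hπ : ∀ T : End ℂ W, (∀ h, T * π h = π h * T) → ∃ c : ℂ, T = c • 1)
    {F : G → (W →ₗ[ℂ] W)} (hF : IsHecke H π F) : funToHecke H π (heckeToFun F) = F := by
  have hH : (Nat.card H : ℂ) ≠ 0 := by simp
  ext1 x
  simp only [funToHecke, heckeToFun, hF.map_mul_left, mul_smul, ← Finset.smul_sum]
  rw [finrank_smul_sum_trace_smul π hπ, inv_smul_smul₀ hH]

theorem IsHecke.memIpi_heckeToFun [FiniteDimensional ℂ W] [Fintype G] [Fintype H]
    [DecidablePred (· ∈ H)]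
    (hπ : ∀ T : End ℂ W, (∀ h, T * π h = π h * T) → ∃ c : ℂ, T = c • 1)
    {F : G → (W →ₗ[ℂ] W)} (hF : IsHecke H π F) : MemIpi H π (heckeToFun F) := by
  have h : convC (ePi H π) (heckeToFun F) = heckeToFun F := by
    rw [← heckeToFun_funToHecke, hF.funToHecke_heckeToFun hπ]
  exact ⟨hF.heckeToFun_conj, h, (convC_ePi_comm hF.heckeToFun_conj).trans h⟩

theorem heckeToFun_heckeConv [FiniteDimensional ℂ W] [Fintype G] [Fintype H]
    (hπ : ∀ T : End ℂ W, (∀ h, T * π h = π h * T) → ∃ c : ℂ, T = c • 1)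
    {F₁ F₂ : G → (W →ₗ[ℂ] W)} (hF₁ : IsHecke H π F₁) (hF₂ : IsHecke H π F₂) :
    heckeToFun (heckeConv F₁ F₂) = convC (heckeToFun F₂) (heckeToFun F₁) := by
  have hH : (Nat.card H : ℂ) ≠ 0 := by simp
  ext x
  let t := LinearMap.trace ℂ W
  have hshift (h : H) : ∑ y : G, t (F₂ y) * t (F₁ (y⁻¹ * x)) =
      ∑ y : G, t (F₂ y * π h⁻¹) * t (F₁ (y⁻¹ * x) * π h) := by
    refine (Fintype.sum_equiv (Equiv.mulRight (h : G)) _ _ fun y => ?_).symm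
    have h₁ := hF₁.map_mul_left h⁻¹ (y⁻¹ * x)
    rw [inv_inv, Subgroup.coe_inv, ← mul_assoc] at h₁
    rw [Equiv.coe_mulRight, mul_inv_rev, hF₂.map_mul_right, h₁, LinearMap.trace_mul_comm]
  have hsum : (finrank ℂ W : ℂ) * ∑ y : G, t (F₂ y) * t (F₁ (y⁻¹ * x)) =
      ∑ y : G, t (F₁ (y⁻¹ * x) * F₂ y) := by
    apply mul_left_cancel₀ hH
    calc (Nat.card H : ℂ) * ((finrank ℂ W : ℂ) * ∑ y : G, t (F₂ y) * t (F₁ (y⁻¹ * x)))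
        = (finrank ℂ W : ℂ) * ∑ _h : H, ∑ y : G, t (F₂ y) * t (F₁ (y⁻¹ * x)) := by
          simp [mul_left_comm]
      _ = (finrank ℂ W : ℂ) *
            ∑ h : H, ∑ y : G, t (F₂ y * π h⁻¹) * t (F₁ (y⁻¹ * x) * π h) :=
          congrArg _ (Finset.sum_congr rfl fun h _ => hshift h)
      _ = (Nat.card H : ℂ) * ∑ y : G, t (F₁ (y⁻¹ * x) * F₂ y) := by
          rw [Finset.sum_comm, Finset.mul_sum, Finset.mul_sum]
          exact Finset.sum_congr rfl fun y _ => finrank_mul_sum_trace_mul_trace π hπ _ _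
  calc heckeToFun (heckeConv F₁ F₂) x
      = (finrank ℂ W : ℂ) *
          ((Fintype.card G : ℂ)⁻¹ * ∑ y : G, t (F₁ (y⁻¹ * x) * F₂ y)) := by
        simp [heckeToFun, heckeConv, t, Module.End.mul_eq_comp]
    _ = convC (heckeToFun F₂) (heckeToFun F₁) x := by
        simp only [← hsum, convC, heckeToFun, Finset.mul_sum]
        exact Finset.sum_congr rfl fun y _ => by ring

end Hecke

/-- **Schur's lemma**: an endomorphism commuting with a simple representation is a scalar. -/
theorem FDRep.exists_eq_smul_one_of_commute {H : Type} [Group H] (π : FDRep ℂ H) [Simple π]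
    (T : End ℂ π) (hT : ∀ h, T * π.ρ h = π.ρ h * T) : ∃ c : ℂ, T = c • 1 := by
  let f : π ⟶ π := FDRep.forget₂HomLinearEquiv π π (Rep.ofHom ⟨T, hT⟩)
  obtain ⟨c, hc⟩ := (finrank_eq_one_iff_of_nonzero' (𝟙 π) (id_nonzero π)).1
    (finrank_endomorphism_simple_eq_one ℂ π) f
  exact ⟨c, (congrArg (fun g : π ⟶ π => g.hom.hom.hom) hc).symm⟩

/-- The map `F ↦ f_F`, `f_F(g) = (dim W)·tr(F(g))`, is a ℂ-linear bijection from the Hecke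
algebra of `(G, H, π)` onto `I_π(G)` reversing the convolution products; its inverse is
`f ↦ F_f`, `F_f(x) = (1/|H|) Σ_{y ∈ H} f(yx)·π(y)`. -/
theorem hecke_anti_isomorphism (G : Type) [Group G] [Fintype G]
    (H : Subgroup G) [Fintype H] [DecidablePred (· ∈ H)]
    (π : FDRep ℂ H) [Simple π] :
    (∀ F : G → (π →ₗ[ℂ] π), IsHecke H π.ρ F → MemIpi H π.ρ (heckeToFun F)) ∧
    (∀ F₁ F₂ : G → (π →ₗ[ℂ] π), heckeToFun (F₁ + F₂) = heckeToFun F₁ + heckeToFun F₂) ∧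
    (∀ (c : ℂ) (F : G → (π →ₗ[ℂ] π)), heckeToFun (c • F) = c • heckeToFun F) ∧
    (∀ F₁ F₂ : G → (π →ₗ[ℂ] π), IsHecke H π.ρ F₁ → IsHecke H π.ρ F₂ →
      heckeToFun (heckeConv F₁ F₂) = convC (heckeToFun F₂) (heckeToFun F₁)) ∧
    (∀ F : G → (π →ₗ[ℂ] π), IsHecke H π.ρ F → funToHecke H π.ρ (heckeToFun F) = F) ∧
    (∀ f : G → ℂ, MemIpi H π.ρ f →
      IsHecke H π.ρ (funToHecke H π.ρ f) ∧ heckeToFun (funToHecke H π.ρ f) = f) := by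
  have hπ := FDRep.exists_eq_smul_one_of_commute π
  refine ⟨fun F hF => hF.memIpi_heckeToFun hπ, fun F₁ F₂ => ?_, fun c F => ?_,
    fun F₁ F₂ hF₁ hF₂ => heckeToFun_heckeConv hπ hF₁ hF₂,
    fun F hF => hF.funToHecke_heckeToFun hπ,
    fun f hf => ⟨isHecke_funToHecke hf.1, (heckeToFun_funToHecke f).trans hf.2.1⟩⟩
  · ext g
    simp [heckeToFun, mul_add]
  · ext g
    simp [heckeToFun, mul_left_comm]
end
end

section
/- Let q ≥ 3 be a prime power, let τ be an irreducible complex representation of GL₂(q) with dim τ = q, and let σ be an irreducible complex representation of GL₂(q) with dim σ = q + 1. Then there exists an irreducible complex representation σ' of GL₂(q) with dim σ' = q + 1 whose multiplicity in the tensor product τ ⊗ σ equals exactly 2; in particular τ ⊗ σ is not multiplicity free. -/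
open CategoryTheory Module MonoidalCategory

noncomputable section

section Preliminaries

open ComplexConjugate

section Fourier

variable {T : Type*} [CommGroup T] [Fintype T] {f : T → ℂ} {n : AddChar (Additive T) ℂ → ℕ}

theorem fourier_inversion
    (h : ∀ ψ, ∑ t, conj (ψ (.ofMul t)) * f t = Fintype.card T * n ψ) (t : T) :
    f t = ∑ ψ, n ψ * ψ (.ofMul t) := by
  classical
  have hT : (Fintype.card T : ℂ) ≠ 0 := by simp
  apply mul_left_cancel₀ hT
  have key (s : T) : ∑ ψ : AddChar (Additive T) ℂ, conj (ψ (.ofMul s)) * ψ (.ofMul t) =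
      if s = t then (Fintype.card T : ℂ) else 0 := by
    have := AddChar.sum_apply_eq_ite (Additive.ofMul t - Additive.ofMul s)
    simp only [sub_eq_zero, AddChar.map_sub_eq_div] at this
    simp only [← AddChar.map_neg_eq_conj, AddChar.map_neg_eq_inv]
    rw [← Fintype.card_congr (Additive.ofMul (α := T))] at this
    convert this using 2
    · rw [div_eq_inv_mul]
    · simp [eq_comm]
  calc (Fintype.card T : ℂ) * f t
      = ∑ s, (∑ ψ : AddChar (Additive T) ℂ, conj (ψ (.ofMul s)) * ψ (.ofMul t)) * f s := by
        simp [key]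
    _ = ∑ ψ : AddChar (Additive T) ℂ, (∑ s, conj (ψ (.ofMul s)) * f s) * ψ (.ofMul t) := by
        simp only [Finset.sum_mul]
        rw [Finset.sum_comm]
        refine Finset.sum_congr rfl fun _ _ => Finset.sum_congr rfl fun _ _ => by ring
    _ = _ := by simp only [h, Finset.mul_sum, mul_assoc]

theorem fourier_parseval
    (h : ∀ ψ, ∑ t, conj (ψ (.ofMul t)) * f t = Fintype.card T * n ψ) :
    ∑ t, conj (f t) * f t = Fintype.card T * ∑ ψ, (n ψ : ℂ) ^ 2 := by
  have : ∀ t, conj (f t) = ∑ ψ, n ψ * conj (ψ (.ofMul t)) := fun t => by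
    conv_lhs => rw [fourier_inversion h t]
    simp
  simp only [this, Finset.sum_mul, Finset.mul_sum]
  rw [Finset.sum_comm]
  refine Finset.sum_congr rfl fun ψ _ => ?_
  simp only [mul_assoc, ← Finset.mul_sum, h]
  ring

end Fourier

section Characters

variable {G : Type} [Group G]

/-- The representation `V` multiplied by the one-dimensional character `l`. -/
def FDRep.twist (V : FDRep ℂ G) (l : G →* ℂ) : FDRep ℂ G :=
  FDRep.of (R := ℂ) (V := V)
    { toFun := fun g => l g • V.ρ g
      map_one' := by simp
      map_mul' := fun g h => by rw [map_mul, map_mul, smul_mul_smul_comm] }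

theorem FDRep.char_twist (V : FDRep ℂ G) (l : G →* ℂ) (g : G) :
    (V.twist l).character g = l g * V.character g :=
  (LinearMap.trace ℂ V).map_smul (l g) (V.ρ g)

theorem FDRep.exists_sum_mul_char (V : FDRep ℂ G) {H : Type} [Group H] [Fintype H]
    (φ : H →* G) (l : H →* ℂ) :
    ∃ n : ℕ, ∑ h, l h * V.character (φ h) = Fintype.card H * n := by
  have hH : (Nat.card H : ℂ) ≠ 0 := by simp
  have := invertibleOfNonzero hH
  have := FDRep.average_char_eq_finrank_invariants
    ((FDRep.of (R := ℂ) (V := V) (V.ρ.comp φ)).twist l)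
  refine ⟨finrank ℂ (Representation.invariants
    ((FDRep.of (R := ℂ) (V := V) (V.ρ.comp φ)).twist l).ρ), ?_⟩
  rw [← Nat.card_eq_fintype_card, ← this, mul_inv_cancel_left₀ hH]
  refine Finset.sum_congr rfl fun h _ => ?_
  rw [FDRep.char_twist]
  rfl

theorem FDRep.char_inv_map (V : FDRep ℂ G) {T : Type} [CommGroup T] [Finite T]
    (φ : T →* G) (t : T) : V.character (φ t⁻¹) = conj (V.character (φ t)) := by
  cases nonempty_fintype T
  have h : ∀ ψ : AddChar (Additive T) ℂ, ∃ n : ℕ,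
      ∑ t, conj (ψ (.ofMul t)) * V.character (φ t) = Fintype.card T * n := fun ψ =>
    V.exists_sum_mul_char φ ((starRingEnd ℂ : ℂ →* ℂ).comp ψ.toMonoidHom)
  choose n hn using h
  rw [fourier_inversion (f := fun t => V.character (φ t)) hn t⁻¹,
    fourier_inversion (f := fun t => V.character (φ t)) hn t, map_sum]
  refine Finset.sum_congr rfl fun ψ _ => ?_
  rw [map_mul, ← AddChar.map_neg_eq_conj]
  simp

theorem FDRep.char_inv [Finite G] (V : FDRep ℂ G) (g : G) :
    V.character g⁻¹ = conj (V.character g) := by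
  let _ : CommGroup (Subgroup.zpowers g) := IsCyclic.commGroup
  exact V.char_inv_map (Subgroup.zpowers g).subtype ⟨g, Subgroup.mem_zpowers g⟩

theorem FDRep.simple_of_sum_normSq [Fintype G] (V : FDRep ℂ G)
    (h : ∑ g, V.character g * conj (V.character g) = Fintype.card G) : Simple V := by
  have : Nonempty G := ⟨1⟩
  rw [FDRep.simple_iff_char_is_norm_one]
  simpa [FDRep.char_inv] using h

end Characters

section Borel

open Matrix

variable {F : Type} [Field F]

/-- The upper triangular matrix with diagonal `(a, b)` and upper right entry `x`. -/
def upper (a b : Fˣ) (x : F) : GL (Fin 2) F :=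
  GeneralLinearGroup.mkOfDetNeZero !![(a : F), x; 0, b] (by simp)

@[simp]
theorem coe_upper (a b : Fˣ) (x : F) :
    (upper a b x : Matrix (Fin 2) (Fin 2) F) = !![(a : F), x; 0, b] := rfl

theorem upper_mul (a b c d : Fˣ) (x y : F) :
    upper a b x * upper c d y = upper (a * c) (b * d) (a * y + x * d) := by
  apply Units.ext
  simp

theorem upper_one : upper (1 : Fˣ) 1 0 = 1 := by
  apply Units.ext
  simp [Matrix.one_fin_two]

theorem upper_inv (a b : Fˣ) (x : F) :
    (upper a b x)⁻¹ = upper a⁻¹ b⁻¹ (-(↑a⁻¹ * x * ↑b⁻¹)) := by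
  rw [inv_eq_iff_mul_eq_one, upper_mul, ← upper_one]
  congr 1 <;> simp [← mul_assoc]

theorem det_upper (a b : Fˣ) (x : F) : GeneralLinearGroup.det (upper a b x) = a * b := by
  apply Units.ext
  simp [Matrix.det_fin_two]

theorem exists_eq_upper {g : GL (Fin 2) F} (hg : g 1 0 = 0) : ∃ a b x, g = upper a b x := by
  have h := g.det_ne_zero
  rw [Matrix.det_fin_two, hg, mul_zero, sub_zero] at h
  refine ⟨Units.mk0 _ (left_ne_zero_of_mul h), Units.mk0 _ (right_ne_zero_of_mul h), g 0 1, ?_⟩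
  apply Units.ext
  ext i j
  fin_cases i <;> fin_cases j <;> simp [hg]

variable (F) in
/-- The subgroup of upper triangular matrices in `GL₂(F)`. -/
def borelGL : Subgroup (GL (Fin 2) F) where
  carrier := {g | g 1 0 = 0}
  one_mem' := by simp
  mul_mem' := by
    rintro g h hg hh
    obtain ⟨a, b, x, rfl⟩ := exists_eq_upper hg
    obtain ⟨c, d, y, rfl⟩ := exists_eq_upper hh
    simp [upper_mul]
  inv_mem' := by
    rintro g hg
    obtain ⟨a, b, x, rfl⟩ := exists_eq_upper hg
    simp [upper_inv]

theorem mem_borelGL {g : GL (Fin 2) F} : g ∈ borelGL F ↔ g 1 0 = 0 := Iff.rfl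

theorem upper_mem_borelGL (a b : Fˣ) (x : F) : upper a b x ∈ borelGL F := by simp [mem_borelGL]

theorem upper_inj {a b c d : Fˣ} {x y : F} (h : upper a b x = upper c d y) :
    a = c ∧ b = d ∧ x = y := by
  have h := congrArg Units.val h
  refine ⟨Units.ext (by simpa using congrFun₂ h 0 0), Units.ext (by simpa using congrFun₂ h 1 1),
    by simpa using congrFun₂ h 0 1⟩

variable (F) in
/-- Coordinates on the Borel subgroup. -/
def borelGLEquiv : Fˣ × Fˣ × F ≃ borelGL F :=
  Equiv.ofBijective (fun t => ⟨upper t.1 t.2.1 t.2.2, upper_mem_borelGL _ _ _⟩) <| by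
    constructor
    · rintro ⟨a, b, x⟩ ⟨c, d, y⟩ h
      obtain ⟨rfl, rfl, rfl⟩ := upper_inj (congrArg Subtype.val h)
      rfl
    · rintro ⟨g, hg⟩
      obtain ⟨a, b, x, rfl⟩ := exists_eq_upper hg
      exact ⟨⟨a, b, x⟩, rfl⟩

variable (F) in
/-- The diagonal entries of an upper triangular matrix, as a group homomorphism. -/
def borelGLDiag : borelGL F →* Fˣ × Fˣ where
  toFun g := (((borelGLEquiv F).symm g).1, ((borelGLEquiv F).symm g).2.1)
  map_one' := by
    have : (borelGLEquiv F).symm 1 = (1, 1, 0) := by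
      rw [Equiv.symm_apply_eq]
      exact Subtype.ext upper_one.symm
    simp [this]
  map_mul' g h := by
    obtain ⟨⟨a, b, x⟩, rfl⟩ := (borelGLEquiv F).surjective g
    obtain ⟨⟨c, d, y⟩, rfl⟩ := (borelGLEquiv F).surjective h
    have : (borelGLEquiv F).symm (borelGLEquiv F (a, b, x) * borelGLEquiv F (c, d, y)) =
        (a * c, b * d, a * y + x * d) := by
      rw [Equiv.symm_apply_eq]
      exact Subtype.ext (upper_mul _ _ _ _ _ _)
    simp [this]

theorem borelGLDiag_borelGLEquiv (t : Fˣ × Fˣ × F) :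
    borelGLDiag F (borelGLEquiv F t) = (t.1, t.2.1) := by simp [borelGLDiag]

theorem coe_borelGLEquiv (t : Fˣ × Fˣ × F) :
    (borelGLEquiv F t : GL (Fin 2) F) = upper t.1 t.2.1 t.2.2 := rfl

theorem conj_mem_borelGL_iff (y g : GL (Fin 2) F) :
    y⁻¹ * g * y ∈ borelGL F ↔ y 0 0 * (g * y) 1 0 = y 1 0 * (g * y) 0 0 := by
  have hy : (y.val.det)⁻¹ ≠ 0 := inv_ne_zero y.det_ne_zero
  rw [mem_borelGL, mul_assoc, Units.val_mul, GeneralLinearGroup.coe_inv, Matrix.inv_def,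
    Ring.inverse_eq_inv', Matrix.adjugate_fin_two, Matrix.mul_apply, Fin.sum_univ_two]
  simp only [Matrix.smul_apply, smul_eq_mul, Matrix.of_apply, Matrix.cons_val', Matrix.cons_val_zero,
    Matrix.cons_val_one, Matrix.cons_val_fin_one, mul_assoc, ← mul_add, mul_eq_zero, hy, false_or]
  rw [← sub_eq_zero (a := _ * _)]
  constructor <;> intro h <;> linear_combination h

theorem conj_upper_mem_borelGL_iff (y : GL (Fin 2) F) (a b : Fˣ) (x : F) :
    y⁻¹ * upper a b x * y ∈ borelGL F ↔ y 1 0 = 0 ∨ (b - a : F) * y 0 0 = x * y 1 0 := by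
  rw [conj_mem_borelGL_iff, Units.val_mul, Matrix.mul_apply, Matrix.mul_apply, Fin.sum_univ_two,
    Fin.sum_univ_two, ← sub_eq_zero (b := x * _)]
  simp only [coe_upper, Matrix.of_apply, Matrix.cons_val', Matrix.cons_val_zero,
    Matrix.cons_val_one, Matrix.cons_val_fin_one]
  rw [← mul_eq_zero]
  constructor <;> intro h <;> linear_combination h

theorem upper_conj (a b c d : Fˣ) (x y : F) :
    upper c d y * upper a b x * (upper c d y)⁻¹ =
      upper a b ((b * y + c * x - a * y) * ↑d⁻¹) := by
  rw [mul_inv_eq_iff_eq_mul, upper_mul, upper_mul, mul_comm c, mul_comm d]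
  congr 1
  simp
  ring

/-- The Weyl element. -/
def weyl : GL (Fin 2) F := GeneralLinearGroup.mkOfDetNeZero !![0, 1; 1, 0] (by simp)

@[simp]
theorem coe_weyl : ((weyl : GL (Fin 2) F) : Matrix (Fin 2) (Fin 2) F) = !![0, 1; 1, 0] := rfl

theorem weyl_conj (a b : Fˣ) : weyl * upper a b 0 * weyl⁻¹ = upper b a 0 := by
  rw [mul_inv_eq_iff_eq_mul]
  apply Units.ext
  simp

section ClassFunction

variable {α : Type*} {h : GL (Fin 2) F → α}

theorem classFun_upper_split (hh : ∀ g y, h (y * g * y⁻¹) = h g)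
    {a b : Fˣ} (hab : a ≠ b) (x : F) :
    h (upper a b x) = h (upper a b 0) := by
  have : (b - a : F) ≠ 0 := sub_ne_zero.2 fun e => hab (Units.ext e.symm)
  rw [← hh (upper a b 0) (upper 1 1 (x / (b - a))), upper_conj]
  congr 2
  simp
  field_simp

theorem classFun_upper_unipotent (hh : ∀ g y, h (y * g * y⁻¹) = h g)
    (a : Fˣ) {x : F} (hx : x ≠ 0) :
    h (upper a a x) = h (upper a a 1) := by
  rw [← hh (upper a a 1) (upper (Units.mk0 x hx) 1 0), upper_conj]
  simp

theorem classFun_upper_swap (hh : ∀ g y, h (y * g * y⁻¹) = h g)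
    (a b : Fˣ) : h (upper a b 0) = h (upper b a 0) := by
  rw [← weyl_conj, hh]

end ClassFunction

variable [Fintype F]

open Classical in
/-- The number of `y` such that `g` lies in `y B y⁻¹`, for `B` the Borel subgroup. -/
def flagCount (g : GL (Fin 2) F) : ℕ := Fintype.card {y : GL (Fin 2) F // y⁻¹ * g * y ∈ borelGL F}

open Classical in
theorem sum_borelGL {M : Type*} [AddCommMonoid M] (h : GL (Fin 2) F → M) :
    ∑ g : borelGL F, h g = ∑ a : Fˣ, ∑ b : Fˣ, ∑ x : F, h (upper a b x) := by
  rw [← (borelGLEquiv F).sum_comp]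
  simp only [coe_borelGLEquiv, Fintype.sum_prod_type]

open Classical in
theorem sum_flagCount_mul {R : Type*} [CommSemiring R] {h : GL (Fin 2) F → R}
    (hh : ∀ g y, h (y * g * y⁻¹) = h g) :
    ∑ g, flagCount g * h g = Fintype.card (GL (Fin 2) F) * ∑ g : borelGL F, h g := by
  have key (y : GL (Fin 2) F) :
      ∑ g, (if y⁻¹ * g * y ∈ borelGL F then h g else 0) = ∑ g : borelGL F, h g := by
    rw [← (MulAut.conj y).toEquiv.sum_comp]
    simp only [MulEquiv.toEquiv_eq_coe, MulEquiv.coe_toEquiv, MulAut.conj_apply, hh]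
    simp only [mul_assoc, inv_mul_cancel, inv_mul_cancel_left, mul_one]
    rw [← Finset.sum_filter, Finset.sum_subtype _ (p := (· ∈ borelGL F))]
    simp
  calc ∑ g, flagCount g * h g
      = ∑ g, ∑ y : GL (Fin 2) F, (if y⁻¹ * g * y ∈ borelGL F then h g else 0) := by
        refine Finset.sum_congr rfl fun g _ => ?_
        rw [← Finset.sum_filter, Finset.sum_const, flagCount, Fintype.card_subtype, nsmul_eq_mul]
    _ = _ := by
        rw [Finset.sum_comm]
        simp [key]

open Classical in
theorem flagCount_conj (g y : GL (Fin 2) F) : flagCount (y * g * y⁻¹) = flagCount g := by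
  refine Fintype.card_congr ((Equiv.mulLeft y⁻¹).subtypeEquiv fun z => ?_)
  simp [mul_assoc]

open Classical in
theorem card_borelGL : Fintype.card (borelGL F) = Fintype.card F * (Fintype.card F - 1) ^ 2 := by
  rw [← Fintype.card_congr (borelGLEquiv F)]
  simp only [Fintype.card_prod, Fintype.card_units]
  ring

open Classical in
theorem card_GL_two :
    Fintype.card (GL (Fin 2) F) = (Fintype.card F + 1) * Fintype.card (borelGL F) := by
  rw [card_borelGL, ← Nat.card_eq_fintype_card, Matrix.card_GL_field, Fin.prod_univ_two]
  obtain ⟨n, hn⟩ : ∃ n, Fintype.card F = n + 1 := ⟨_, (Nat.succ_pred Fintype.card_ne_zero).symm⟩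
  simp only [hn, Fin.val_zero, Fin.val_one, Nat.add_sub_cancel, pow_zero, pow_one]
  have h1 : (n + 1) ^ 2 - 1 = n * (n + 2) := by rw [Nat.sub_eq_iff_eq_add (by nlinarith)]; ring
  have h2 : (n + 1) ^ 2 - (n + 1) = n * (n + 1) := by
    rw [Nat.sub_eq_iff_eq_add (by nlinarith)]; ring
  rw [h1, h2]
  ring

open Classical in
theorem flagCount_central (a : Fˣ) : flagCount (upper a a 0) = Fintype.card (GL (Fin 2) F) := by
  refine Fintype.card_of_subtype Finset.univ fun y => ?_
  simp [conj_upper_mem_borelGL_iff]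

open Classical in
theorem flagCount_unipotent (a : Fˣ) {x : F} (hx : x ≠ 0) :
    flagCount (upper a a x) = Fintype.card (borelGL F) := by
  refine Fintype.card_congr (Equiv.subtypeEquivRight fun y => ?_)
  rw [conj_upper_mem_borelGL_iff, mem_borelGL]
  simp [hx, eq_comm]

open Classical in
theorem flagCount_split {a b : Fˣ} (hab : a ≠ b) (x : F) :
    flagCount (upper a b x) = 2 * Fintype.card (borelGL F) := by
  have hba : (b - a : F) ≠ 0 := sub_ne_zero.2 fun e => hab (Units.ext e.symm)
  rw [classFun_upper_split (h := flagCount) flagCount_conj hab, flagCount]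
  have e : {y : GL (Fin 2) F // y⁻¹ * upper a b 0 * y ∈ borelGL F} ≃
      {y : GL (Fin 2) F // y ∈ borelGL F ∨ weyl * y ∈ borelGL F} := by
    refine Equiv.subtypeEquivRight fun y => ?_
    rw [conj_upper_mem_borelGL_iff, mem_borelGL, mem_borelGL, Units.val_mul, Matrix.mul_apply]
    simp [hba]
  rw [Fintype.card_congr e, Fintype.card_subtype_or_disjoint, two_mul]
  · congr 1
    exact Fintype.card_congr ((Equiv.mulLeft weyl).subtypeEquiv fun z => Iff.rfl)
  · rw [Pi.disjoint_iff]
    intro y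
    rw [Prop.disjoint_iff]
    rw [not_and]
    intro h1 h2
    rw [mem_borelGL] at h1 h2
    rw [Units.val_mul, Matrix.mul_apply] at h2
    simp at h2
    apply y.det_ne_zero
    rw [Matrix.det_fin_two, h1, h2]
    simp

end Borel

section Simple

theorem FDRep.exists_char_central_mul {G : Type} [Group G] [Finite G] (V : FDRep ℂ G) [Simple V]
    (hV : finrank ℂ V ≠ 0) {z : G} (hz : ∀ g, z * g = g * z) :
    ∃ c : ℂ, ‖c‖ = 1 ∧ ∀ g, V.character (z * g) = c * V.character g := by
  let φ : V ⟶ V := ⟨Action.ρ V z, fun g => by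
    have h1 : Action.ρ V z * Action.ρ V g = Action.ρ V g * Action.ρ V z := by
      rw [← map_mul, ← map_mul, hz]
    exact h1⟩
  obtain ⟨c, hc⟩ := endomorphism_simple_eq_smul_id ℂ φ
  have hρ : V.ρ z = c • 1 := by
    have : φ.hom.hom.hom = (c • 𝟙 V : V ⟶ V).hom.hom.hom := by rw [hc]
    exact this
  refine ⟨c, ?_, fun g => ?_⟩
  · obtain ⟨k, hk, hzk⟩ := isOfFinOrder_iff_pow_eq_one.1 (isOfFinOrder_of_finite z)
    refine Complex.norm_eq_one_of_pow_eq_one (n := k) ?_ hk.ne'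
    have h1 : V.ρ (z ^ k) = c ^ k • 1 := by rw [map_pow, hρ, smul_pow, one_pow]
    have h2 := congrArg (LinearMap.trace ℂ V) h1
    rw [hzk, map_one, map_smul, LinearMap.trace_one, smul_eq_mul] at h2
    exact (mul_eq_right₀ (Nat.cast_ne_zero.2 hV)).1 h2.symm
  · rw [FDRep.character, FDRep.character, map_mul, hρ, smul_mul_assoc, one_mul, map_smul,
      smul_eq_mul]

theorem FDRep.sum_normSq_char {G : Type} [Group G] [Fintype G] (V : FDRep ℂ G) [Simple V] :
    ∑ g, Complex.normSq (V.character g) = Fintype.card G := by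
  have := (FDRep.simple_iff_char_is_norm_one V).1 inferInstance
  rw [Nat.card_eq_fintype_card] at this
  simp only [FDRep.char_inv, Complex.mul_conj] at this
  exact_mod_cast this

end Simple

section BorelSums

open Matrix
open scoped Classical

variable {F : Type} [Field F] [Fintype F]

theorem sum_borelGL_classFun {R : Type*} [CommRing R] {h : GL (Fin 2) F → R}
    (hh : ∀ g y, h (y * g * y⁻¹) = h g) {k : Fˣ × Fˣ → R}
    (hk : ∀ a b, a ≠ b → h (upper a b 0) = k (a, b)) :
    ∑ g : borelGL F, h g = ∑ a, (h (upper a a 0) + (Fintype.card F - 1) * h (upper a a 1) -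
      Fintype.card F * k (a, a)) + Fintype.card F * ∑ t, k t := by
  have hF : ((Fintype.card F - 1 : ℕ) : R) = Fintype.card F - 1 := by
    rw [Nat.cast_sub Fintype.card_pos, Nat.cast_one]
  have key (a b : Fˣ) : ∑ x, h (upper a b x) = Fintype.card F * k (a, b) +
      if a = b then h (upper a a 0) + (Fintype.card F - 1) * h (upper a a 1) -
      Fintype.card F * k (a, a) else 0 := by
    split_ifs with hab
    · subst hab
      rw [← Finset.add_sum_erase _ _ (Finset.mem_univ 0), Finset.sum_congr rfl fun x hx =>
        classFun_upper_unipotent hh a (Finset.ne_of_mem_erase hx)]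
      simp [hF]
    · simp_rw [classFun_upper_split hh hab, hk a b hab]
      simp
  rw [sum_borelGL]
  simp_rw [key, Finset.sum_add_distrib, Fintype.sum_prod_type, Finset.mul_sum]
  simp [add_comm]

theorem card_units_cast (R : Type*) [Ring R] : (Fintype.card Fˣ : R) = Fintype.card F - 1 := by
  rw [Fintype.card_units, Nat.cast_sub Fintype.card_pos, Nat.cast_one]

theorem card_borelGL_cast (R : Type*) [CommRing R] :
    (Fintype.card (borelGL F) : R) = Fintype.card F * (Fintype.card F - 1) ^ 2 := by
  rw [card_borelGL]
  push_cast [Nat.cast_sub (R := R) (Fintype.card_pos (α := F))]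
  rfl

/-- The character of the torus on the invariants of the unipotent radical. -/
def FDRep.torusChar (V : FDRep ℂ (GL (Fin 2) F)) (t : Fˣ × Fˣ) : ℂ :=
  (∑ x : F, V.character (upper t.1 t.2 x)) / Fintype.card F

variable (V : FDRep ℂ (GL (Fin 2) F))

theorem FDRep.torusChar_split {a b : Fˣ} (hab : a ≠ b) :
    V.character (upper a b 0) = V.torusChar (a, b) := by
  have : (Fintype.card F : ℂ) ≠ 0 := by simp
  simp only [FDRep.torusChar, classFun_upper_split V.char_conj hab]
  simp [this]

theorem FDRep.exists_sum_mul_torusChar (ψ : AddChar (Additive (Fˣ × Fˣ)) ℂ) :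
    ∃ n : ℕ, ∑ t, conj (ψ (.ofMul t)) * V.torusChar t = Fintype.card (Fˣ × Fˣ) * n := by
  have hF : (Fintype.card F : ℂ) ≠ 0 := by simp
  obtain ⟨n, hn⟩ := V.exists_sum_mul_char (borelGL F).subtype
    (((starRingEnd ℂ : ℂ →* ℂ).comp ψ.toMonoidHom).comp (borelGLDiag F))
  refine ⟨n, ?_⟩
  rw [← (borelGLEquiv F).sum_comp, ← Fintype.card_congr (borelGLEquiv F)] at hn
  apply mul_left_cancel₀ hF
  calc (Fintype.card F : ℂ) * ∑ t, conj (ψ (.ofMul t)) * V.torusChar t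
      = ∑ t : Fˣ × Fˣ × F, conj (ψ (.ofMul (t.1, t.2.1))) *
          V.character (upper t.1 t.2.1 t.2.2) := by
        simp only [FDRep.torusChar, Fintype.sum_prod_type, Finset.mul_sum]
        refine Finset.sum_congr rfl fun a _ => Finset.sum_congr rfl fun b _ => ?_
        rw [← Finset.mul_sum]
        field_simp
    _ = _ := by
        refine Eq.trans ?_ (hn.trans ?_)
        · refine Finset.sum_congr rfl fun t _ => ?_
          change _ = conj (ψ (.ofMul (borelGLDiag F (borelGLEquiv F t)))) *
            V.character (upper t.1 t.2.1 t.2.2)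
          rw [borelGLDiag_borelGLEquiv]
        · simp only [Fintype.card_prod]
          push_cast
          ring

theorem FDRep.exists_finrank_eq_add :
    ∃ n m : ℕ, (finrank ℂ V : ℂ) = n + (Fintype.card F - 1) * m ∧
      V.character (upper 1 1 1) = n - m := by
  have hF : (Fintype.card F : ℂ) ≠ 0 := by simp
  let φ : Multiplicative F →* GL (Fin 2) F :=
    { toFun := fun x => upper 1 1 x.toAdd
      map_one' := upper_one
      map_mul' := fun x y => by simp [upper_mul, add_comm] }
  have key (ψ : AddChar F ℂ) : ∃ n : ℕ, finrank ℂ V - V.character (upper 1 1 1) +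
      V.character (upper 1 1 1) * ∑ x, ψ x = Fintype.card F * n := by
    obtain ⟨n, hn⟩ := V.exists_sum_mul_char φ ψ.toMonoidHom
    refine ⟨n, ?_⟩
    rw [← Multiplicative.ofAdd.sum_comp, ← Fintype.card_congr Multiplicative.ofAdd] at hn
    have h1 : ∑ x : F, ψ x * V.character (upper 1 1 x) = Fintype.card F * n := hn
    have h2 : ∑ x ∈ Finset.univ.erase (0 : F), ψ x * V.character (upper 1 1 x) =
        (∑ x ∈ Finset.univ.erase (0 : F), ψ x) * V.character (upper 1 1 1) := by
      rw [Finset.sum_mul]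
      refine Finset.sum_congr rfl fun x hx => ?_
      rw [classFun_upper_unipotent V.char_conj 1 (Finset.ne_of_mem_erase hx)]
    rw [← Finset.add_sum_erase _ _ (Finset.mem_univ 0), h2, upper_one, V.char_one,
      AddChar.map_zero_eq_one] at h1
    rw [← Finset.add_sum_erase _ ψ (Finset.mem_univ 0), AddChar.map_zero_eq_one]
    linear_combination h1
  obtain ⟨ψ, hψ⟩ := AddChar.exists_apply_ne_zero.2 (one_ne_zero (α := F))
  obtain ⟨n, hn⟩ := key 1
  obtain ⟨m, hm⟩ := key ψ
  rw [AddChar.sum_eq_zero_of_ne_one (by rintro rfl; simp at hψ)] at hm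
  simp only [AddChar.one_apply, Finset.sum_const, Finset.card_univ, nsmul_eq_mul] at hn
  have hc : V.character (upper 1 1 1) = n - m := by
    apply mul_left_cancel₀ hF
    linear_combination hn - hm
  refine ⟨n, m, ?_, hc⟩
  rw [hc] at hm
  linear_combination hm

end BorelSums

section Multiplicities

open Matrix
open scoped Classical

variable {F : Type} [Field F] [Fintype F] (V : FDRep ℂ (GL (Fin 2) F))

theorem FDRep.sum_borelGL_div_flagCount_le [Simple V] :
    ∑ g : borelGL F, Complex.normSq (V.character g) / flagCount (g : GL (Fin 2) F) ≤ 1 := by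
  have hG : (0 : ℝ) < Fintype.card (GL (Fin 2) F) := by exact_mod_cast Fintype.card_pos
  have h := sum_flagCount_mul (h := fun g => Complex.normSq (V.character g) / (flagCount g : ℝ))
    fun g y => by simp only [V.char_conj, flagCount_conj]
  refine le_of_mul_le_mul_left ?_ hG
  rw [← h, mul_one, ← V.sum_normSq_char]
  refine Finset.sum_le_sum fun g _ => ?_
  by_cases hg : (flagCount g : ℝ) = 0
  · simpa [hg] using Complex.normSq_nonneg _
  · rw [mul_div_cancel₀ _ hg]

/-- The numerical data attached to a simple representation of `GL₂(F)`: the dimension `n` of the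
invariants of the unipotent radical, the multiplicity `m` of the other characters of the unipotent
radical, the central character `ω` and the multiplicities `k` of the characters of the torus. -/
theorem FDRep.exists_multiplicities [Simple V] (hV : finrank ℂ V ≠ 0) :
    ∃ (n m : ℕ) (ω : Fˣ → ℂ) (k : AddChar (Additive (Fˣ × Fˣ)) ℂ → ℕ),
      (∀ a, ‖ω a‖ = 1) ∧ (finrank ℂ V : ℂ) = n + (Fintype.card F - 1) * m ∧
      (∀ a, V.character (upper a a 0) = ω a * (n + (Fintype.card F - 1) * m)) ∧
      (∀ a, V.character (upper a a 1) = ω a * (n - m)) ∧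
      (∀ a, V.torusChar (a, a) = ω a * n) ∧
      (∀ t, V.torusChar t = ∑ ψ, k ψ * ψ (.ofMul t)) ∧
      ∑ ψ, k ψ = n ∧
      ∑ t, Complex.normSq (V.torusChar t) = (Fintype.card F - 1) ^ 2 * ∑ ψ, k ψ ^ 2 := by
  have hF : (Fintype.card F : ℂ) ≠ 0 := by simp
  obtain ⟨n, m, hd, hc⟩ := V.exists_finrank_eq_add
  have hz (a : Fˣ) : ∃ c : ℂ, ‖c‖ = 1 ∧ ∀ g, V.character (upper a a 0 * g) = c * V.character g := by
    refine V.exists_char_central_mul hV fun g => Units.ext ?_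
    have : (upper a a 0 : Matrix (Fin 2) (Fin 2) F) = (a : F) • 1 := by
      ext i j
      fin_cases i <;> fin_cases j <;> simp
    rw [Units.val_mul, Units.val_mul, this]
    simp
  choose ω hω hωf using hz
  choose k hk using V.exists_sum_mul_torusChar
  have h0 (a : Fˣ) : V.character (upper a a 0) = ω a * (n + (Fintype.card F - 1) * m) := by
    rw [← hd, ← V.char_one, ← hωf, mul_one]
  have h1 (a : Fˣ) {x : F} (hx : x ≠ 0) : V.character (upper a a x) = ω a * (n - m) := by
    rw [classFun_upper_unipotent V.char_conj a hx, ← hc,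
      ← classFun_upper_unipotent V.char_conj 1 (inv_ne_zero a.ne_zero), ← hωf, upper_mul]
    simp
  have h2 (a : Fˣ) : V.torusChar (a, a) = ω a * n := by
    rw [FDRep.torusChar, ← Finset.add_sum_erase _ _ (Finset.mem_univ 0), h0,
      Finset.sum_congr rfl fun x hx => h1 a (Finset.ne_of_mem_erase hx), Finset.sum_const,
      Finset.card_erase_of_mem (Finset.mem_univ _), Finset.card_univ, nsmul_eq_mul,
      Nat.cast_sub Fintype.card_pos, div_eq_iff hF]
    push_cast
    ring
  have hinv := fourier_inversion hk
  refine ⟨n, m, ω, k, hω, hd, h0, fun a => h1 a one_ne_zero, h2, hinv, ?_, ?_⟩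
  · have hω1 : ω 1 = 1 := by
      have := hωf 1 1
      rw [upper_one, mul_one, V.char_one] at this
      exact (mul_eq_right₀ (Nat.cast_ne_zero.2 hV)).1 this.symm
    have h3 := hinv 1
    rw [show (1 : Fˣ × Fˣ) = (1, 1) from rfl, h2, hω1, one_mul] at h3
    have h4 (ψ : AddChar (Additive (Fˣ × Fˣ)) ℂ) : ψ (.ofMul (1, 1)) = 1 := ψ.map_zero_eq_one
    simp only [h4, mul_one] at h3
    exact_mod_cast h3.symm
  · have h3 := fourier_parseval hk
    simp only [mul_comm (conj _), Complex.mul_conj] at h3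
    rw [Fintype.card_prod, Nat.cast_mul, card_units_cast, ← sq] at h3
    exact_mod_cast h3

theorem sum_prod_self_le {α : Type*} [Fintype α] {f : α × α → ℝ} (hf : ∀ t, 0 ≤ f t) :
    ∑ a, f (a, a) ≤ ∑ t, f t := by
  rw [Fintype.sum_prod_type]
  exact Finset.sum_le_sum fun a _ =>
    Finset.single_le_sum (f := fun b => f (a, b)) (fun b _ => hf _) (Finset.mem_univ a)

theorem FDRep.multiplicities_inequality [Simple V] {n m S : ℕ} {ω : Fˣ → ℂ}
    (hq : 2 ≤ Fintype.card F) (hω : ∀ a, ‖ω a‖ = 1)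
    (h0 : ∀ a, V.character (upper a a 0) = ω a * (n + (Fintype.card F - 1) * m))
    (h1 : ∀ a, V.character (upper a a 1) = ω a * (n - m))
    (h2 : ∀ a, V.torusChar (a, a) = ω a * n)
    (hS : ∑ t, Complex.normSq (V.torusChar t) = (Fintype.card F - 1) ^ 2 * S) :
    2 * (n + (Fintype.card F - 1) * m : ℝ) ^ 2 + (Fintype.card F + 1) *
      (2 * (Fintype.card F - 1) * (n - m) ^ 2 +
        Fintype.card F * ((Fintype.card F - 1) * S - n ^ 2)) ≤
      2 * Fintype.card F * (Fintype.card F - 1) * (Fintype.card F + 1) ∧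
    (n : ℝ) ^ 2 ≤ (Fintype.card F - 1) * S := by
  have hω' (a : Fˣ) : Complex.normSq (ω a) = 1 := by rw [Complex.normSq_eq_norm_sq, hω]; simp
  have hn0 (a : Fˣ) : Complex.normSq (V.character (upper a a 0)) =
      (n + (Fintype.card F - 1) * m : ℝ) ^ 2 := by
    rw [h0, map_mul, hω', one_mul, sq, ← Complex.normSq_ofReal]
    push_cast
    rfl
  have hn1 (a : Fˣ) : Complex.normSq (V.character (upper a a 1)) = (n - m : ℝ) ^ 2 := by
    rw [h1, map_mul, hω', one_mul, sq, ← Complex.normSq_ofReal]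
    push_cast
    rfl
  have hn2 (a : Fˣ) : Complex.normSq (V.torusChar (a, a)) = (n : ℝ) ^ 2 := by
    rw [h2, map_mul, hω', one_mul, sq, ← Complex.normSq_ofReal]
    push_cast
    rfl
  have hq1 : (0 : ℝ) < Fintype.card F - 1 := by
    have : (2 : ℝ) ≤ Fintype.card F := by exact_mod_cast hq
    linarith
  constructor
  · have hle := V.sum_borelGL_div_flagCount_le
    rw [sum_borelGL_classFun
      (h := fun g => Complex.normSq (V.character g) / (flagCount g : ℝ))
      (k := fun t => Complex.normSq (V.torusChar t) / (2 * Fintype.card (borelGL F) : ℕ))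
      (fun g y => by simp only [V.char_conj, flagCount_conj])
      (fun a b hab => by rw [V.torusChar_split hab, flagCount_split hab])] at hle
    simp only [hn0, hn1, hn2, flagCount_central, flagCount_unipotent _ one_ne_zero,
      ← Finset.sum_div, hS, Finset.sum_const, Finset.card_univ, nsmul_eq_mul, card_GL_two,
      Nat.cast_mul, card_units_cast, card_borelGL_cast] at hle
    push_cast at hle
    generalize (Fintype.card F : ℝ) = q at *
    have hq0 : 0 < q := by linarith
    have e : (2 * (n + (q - 1) * m : ℝ) ^ 2 + (q + 1) *
      (2 * (q - 1) * (n - m) ^ 2 + q * ((q - 1) * S - n ^ 2))) / (2 * q * (q - 1) * (q + 1)) ≤ 1 := by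
      refine le_of_eq_of_le ?_ hle
      have : q - 1 ≠ 0 := hq1.ne'
      field_simp
      ring
    rwa [div_le_one (by positivity)] at e
  · have := sum_prod_self_le (f := fun t => Complex.normSq (V.torusChar t))
      fun _ => Complex.normSq_nonneg _
    rw [hS] at this
    simp only [hn2, Finset.sum_const, Finset.card_univ, nsmul_eq_mul, card_units_cast] at this
    rw [sq ((Fintype.card F : ℝ) - 1), mul_assoc] at this
    exact le_of_mul_le_mul_left this hq1

end Multiplicities

section SmallDegrees

open Matrix
open scoped Classical

variable {F : Type} [Field F] [Fintype F] (V : FDRep ℂ (GL (Fin 2) F))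

theorem multiplicities_of_dim_eq_card {q n m S : ℕ} (hq : 3 ≤ q)
    (hd : (q : ℝ) = n + (q - 1) * m)
    (h : 2 * (n + (q - 1) * m : ℝ) ^ 2 + (q + 1) * (2 * (q - 1) * (n - m) ^ 2 +
      q * ((q - 1) * S - n ^ 2)) ≤ 2 * q * (q - 1) * (q + 1))
    (hS : (n : ℝ) ^ 2 ≤ (q - 1) * S) : n = 1 ∧ m = 1 := by
  have hq' : (3 : ℝ) ≤ q := by exact_mod_cast hq
  have hn : (0 : ℝ) ≤ n := n.cast_nonneg
  obtain _ | _ | m := m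
  · exfalso
    have hnq : (n : ℝ) = q := by simpa using hd.symm
    rw [hnq] at h hS
    have : (0 : ℝ) ≤ (q + 1) * (q * ((q - 1) * S - q ^ 2)) := by
      have := sub_nonneg.2 hS
      positivity
    push_cast at h
    nlinarith [mul_pos (show (0 : ℝ) < q - 1 by linarith) (show (0 : ℝ) < q by linarith)]
  · refine ⟨?_, rfl⟩
    have : (n : ℝ) = 1 := by push_cast at hd; linarith
    exact_mod_cast this
  · exfalso
    push_cast at hd
    nlinarith [m.cast_nonneg (α := ℝ)]

theorem multiplicities_of_dim_eq_card_add_one {q n m S : ℕ} (hq : 3 ≤ q)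
    (hd : (q + 1 : ℝ) = n + (q - 1) * m)
    (h : 2 * (n + (q - 1) * m : ℝ) ^ 2 + (q + 1) * (2 * (q - 1) * (n - m) ^ 2 +
      q * ((q - 1) * S - n ^ 2)) ≤ 2 * q * (q - 1) * (q + 1))
    (hS : (n : ℝ) ^ 2 ≤ (q - 1) * S) : n = 2 ∧ m = 1 ∧ S ≤ 2 := by
  have hq' : (3 : ℝ) ≤ q := by exact_mod_cast hq
  have hn : (0 : ℝ) ≤ n := n.cast_nonneg
  obtain _ | _ | m := m
  · exfalso
    have hnq : (n : ℝ) = q + 1 := by simpa using hd.symm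
    rw [hnq] at h hS
    have : (0 : ℝ) ≤ (q + 1) * (q * ((q - 1) * S - (q + 1) ^ 2)) := by
      have := sub_nonneg.2 hS
      positivity
    push_cast at h
    nlinarith [mul_pos (show (0 : ℝ) < q - 1 by linarith) (show (0 : ℝ) < q by linarith)]
  · have hn2 : (n : ℝ) = 2 := by push_cast at hd; linarith
    refine ⟨by exact_mod_cast hn2, rfl, ?_⟩
    rw [hn2] at h
    push_cast at h
    have hpos : (0 : ℝ) < q * (q - 1) * (q + 1) := by
      have : (0 : ℝ) < q - 1 := by linarith
      positivity
    have : (q * (q - 1) * (q + 1) : ℝ) * S ≤ q * (q - 1) * (q + 1) * 2 := by linarith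
    exact_mod_cast le_of_mul_le_mul_left this hpos
  · exfalso
    have hm : (0 : ℝ) ≤ m := m.cast_nonneg
    push_cast at hd
    have hq3 : (q : ℝ) = 3 := by nlinarith
    rw [hq3] at hd h hS
    have hm0 : (m : ℝ) = 0 := by linarith
    have hn0 : (n : ℝ) = 0 := by linarith
    rw [hn0] at h hS
    push_cast at h
    rw [hm0] at h
    linarith

theorem FDRep.sum_borelGL_normSq_char [Simple V] (hq : 3 ≤ Fintype.card F)
    (hV : finrank ℂ V = Fintype.card F + 1) :
    ∑ g : borelGL F, Complex.normSq (V.character g) = 3 * Fintype.card (borelGL F) := by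
  obtain ⟨n, m, ω, k, hω, hd, h0, h1, h2, -, hsum, hS⟩ := V.exists_multiplicities (by omega)
  obtain ⟨hle, hle'⟩ := V.multiplicities_inequality (S := ∑ ψ, k ψ ^ 2) (by omega) hω h0 h1 h2
    (by rw [hS, Nat.cast_sum])
  rw [hV] at hd
  push_cast at hd
  obtain ⟨rfl, rfl, hS2⟩ := multiplicities_of_dim_eq_card_add_one hq (by exact_mod_cast hd) hle hle'
  have hS3 : ∑ ψ, k ψ ^ 2 = 2 := by
    refine hS2.antisymm (hsum.symm.trans_le ?_)
    exact Finset.sum_le_sum fun ψ _ => Nat.le_self_pow two_ne_zero _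
  have hω' (a : Fˣ) : Complex.normSq (ω a) = 1 := by rw [Complex.normSq_eq_norm_sq, hω]; simp
  have hn0 (a : Fˣ) :
      Complex.normSq (V.character (upper a a 0)) = (Fintype.card F + 1 : ℝ) ^ 2 := by
    rw [h0, ← hd, map_mul, hω', one_mul, sq, ← Complex.normSq_ofReal]
    push_cast
    rfl
  have hn1 (a : Fˣ) : Complex.normSq (V.character (upper a a 1)) = 1 := by
    rw [h1, map_mul, hω', one_mul]
    norm_num
  have hn2 (a : Fˣ) : Complex.normSq (V.torusChar (a, a)) = 4 := by
    rw [h2, map_mul, hω', one_mul]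
    norm_num
  rw [sum_borelGL_classFun (h := fun g => Complex.normSq (V.character g))
    (k := fun t => Complex.normSq (V.torusChar t)) (fun g y => by rw [V.char_conj])
    (fun a b hab => by rw [V.torusChar_split hab])]
  rw [hS3] at hS
  simp only [hn0, hn1, hn2, hS, Finset.sum_const, Finset.card_univ, nsmul_eq_mul,
    card_units_cast, card_borelGL_cast]
  push_cast
  ring

/-- The number of fixed points on the projective line, i.e. the permutation character. -/
def flagChar (g : GL (Fin 2) F) : ℂ := flagCount g / Fintype.card (borelGL F)

theorem sum_flagChar_mul {h : GL (Fin 2) F → ℂ} (hh : ∀ g y, h (y * g * y⁻¹) = h g) :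
    ∑ g, flagChar g * h g = (Fintype.card F + 1) * ∑ g : borelGL F, h g := by
  have hB : (Fintype.card (borelGL F) : ℂ) ≠ 0 := by simp
  have := sum_flagCount_mul hh
  rw [card_GL_two] at this
  push_cast at this
  simp only [flagChar, div_mul_eq_mul_div, ← Finset.sum_div, this]
  field_simp

theorem flagChar_conj (g y : GL (Fin 2) F) : flagChar (y * g * y⁻¹) = flagChar g := by
  rw [flagChar, flagChar, flagCount_conj]

theorem flagChar_central (a : Fˣ) : flagChar (upper a a 0) = Fintype.card F + 1 := by
  have hB : (Fintype.card (borelGL F) : ℂ) ≠ 0 := by simp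
  rw [flagChar, flagCount_central, card_GL_two]
  push_cast
  field_simp

theorem flagChar_unipotent (a : Fˣ) {x : F} (hx : x ≠ 0) : flagChar (upper a a x) = 1 := by
  have hB : (Fintype.card (borelGL F) : ℂ) ≠ 0 := by simp
  rw [flagChar, flagCount_unipotent a hx, div_self hB]

theorem flagChar_split {a b : Fˣ} (hab : a ≠ b) (x : F) : flagChar (upper a b x) = 2 := by
  have hB : (Fintype.card (borelGL F) : ℂ) ≠ 0 := by simp
  rw [flagChar, flagCount_split hab]
  push_cast
  field_simp

theorem conj_flagChar (g : GL (Fin 2) F) : conj (flagChar g) = flagChar g := by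
  simp [flagChar]

theorem sum_flagChar : ∑ g : GL (Fin 2) F, flagChar g = Fintype.card (GL (Fin 2) F) := by
  have := sum_flagChar_mul (F := F) (h := fun _ => 1) fun _ _ => rfl
  simp only [mul_one, Finset.sum_const, Finset.card_univ, nsmul_eq_mul] at this
  rw [this, card_GL_two]
  push_cast
  rfl

theorem sum_borelGL_flagChar :
    ∑ g : borelGL F, flagChar (g : GL (Fin 2) F) = 2 * Fintype.card (borelGL F) := by
  rw [sum_borelGL_classFun (k := fun _ => 2) flagChar_conj fun a b hab => flagChar_split hab 0]
  simp only [flagChar_central, flagChar_unipotent _ one_ne_zero, Finset.sum_const,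
    Finset.card_univ, nsmul_eq_mul, Fintype.card_prod, Nat.cast_mul, card_units_cast,
    card_borelGL_cast]
  ring

theorem FDRep.exists_character_borelGL [Simple V] (hq : 3 ≤ Fintype.card F)
    (hV : finrank ℂ V = Fintype.card F) :
    ∃ ψ : Fˣ →* ℂ, ∀ g ∈ borelGL F, V.character g =
      ψ (GeneralLinearGroup.det g) * (flagChar g - 1) := by
  obtain ⟨n, m, ω, k, hω, hd, h0, h1, h2, hk, hsum, hS⟩ := V.exists_multiplicities (by omega)
  obtain ⟨hle, hle'⟩ := V.multiplicities_inequality (S := ∑ ψ, k ψ ^ 2) (by omega) hω h0 h1 h2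
    (by rw [hS, Nat.cast_sum])
  rw [hV] at hd
  obtain ⟨rfl, rfl⟩ := multiplicities_of_dim_eq_card hq (by exact_mod_cast hd) hle hle'
  obtain ⟨μ, hμ⟩ := (Finsupp.sum_eq_one_iff (Finsupp.equivFunOnFinite.symm k)).1 <| by
    rw [Finsupp.sum_fintype _ _ fun _ => rfl]
    exact hsum
  have hkμ (ν) : k ν = Finsupp.single μ 1 ν := by rw [← hμ]; rfl
  have hs (t : Fˣ × Fˣ) : V.torusChar t = μ (.ofMul t) := by
    rw [hk, Finset.sum_eq_single μ (fun ν _ hν => by simp [hkμ, hν.symm]) (by simp), hkμ]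
    simp
  have hswap (a b : Fˣ) : μ (.ofMul (a, b)) = μ (.ofMul (b, a)) := by
    by_cases hab : a = b
    · rw [hab]
    · rw [← hs, ← hs, ← V.torusChar_split hab, ← V.torusChar_split (Ne.symm hab),
        classFun_upper_swap V.char_conj]
  let ψ : Fˣ →* ℂ := μ.toMonoidHom.comp (MonoidHom.inl Fˣ Fˣ)
  have hψ (a b : Fˣ) : μ (.ofMul (a, b)) = ψ (a * b) := by
    rw [map_mul]
    change _ = μ (.ofMul (a, 1)) * μ (.ofMul (b, 1))
    rw [hswap b 1, ← μ.map_add_eq_mul, ← ofMul_mul, Prod.mk_mul_mk, mul_one, one_mul]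
  have hω (a : Fˣ) : ω a = ψ (a * a) := by
    rw [← hψ, ← hs, h2]
    simp
  refine ⟨ψ, fun g hg => ?_⟩
  obtain ⟨a, b, x, rfl⟩ := exists_eq_upper hg
  rw [det_upper]
  by_cases hab : a = b
  · subst hab
    by_cases hx : x = 0
    · rw [hx, h0, flagChar_central, hω]
      push_cast
      ring
    · rw [classFun_upper_unipotent V.char_conj a hx, h1, flagChar_unipotent a hx]
      simp
  · rw [classFun_upper_split V.char_conj hab, V.torusChar_split hab, hs, hψ, flagChar_split hab]
    ring

theorem MonoidHom.mul_conj_eq_one {G : Type} [Group G] [Finite G] (l : G →* ℂ) (g : G) :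
    l g * conj (l g) = 1 := by
  obtain ⟨k, hk, h⟩ := isOfFinOrder_iff_pow_eq_one.1 (isOfFinOrder_of_finite g)
  have : ‖l g‖ = 1 :=
    Complex.norm_eq_one_of_pow_eq_one (n := k) (by rw [← map_pow, h, map_one]) hk.ne'
  rw [Complex.mul_conj, Complex.normSq_eq_norm_sq, this]
  simp

theorem FDRep.simple_twist {G : Type} [Group G] [Fintype G] (W : FDRep ℂ G) [Simple W]
    (l : G →* ℂ) : Simple (W.twist l) := by
  refine FDRep.simple_of_sum_normSq _ ?_
  have h (g : G) : (W.twist l).character g * conj ((W.twist l).character g) =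
      Complex.normSq (W.character g) := by
    rw [FDRep.char_twist, map_mul, mul_mul_mul_comm, l.mul_conj_eq_one, one_mul, Complex.mul_conj]
  simp only [h, ← Complex.ofReal_sum, W.sum_normSq_char]
  simp

theorem FDRep.sum_char_mul_eq_zero {G : Type} [Group G] [Fintype G] (W : FDRep ℂ G) [Simple W]
    (hW : finrank ℂ W ≠ 1) (l : G →* ℂ) : ∑ g, W.character g * conj (l g) = 0 := by
  let L : FDRep ℂ G := (FDRep.of (1 : Representation ℂ G ℂ)).twist l
  have hL (g : G) : L.character g = l g := by
    have : (FDRep.of (1 : Representation ℂ G ℂ)).character g = 1 := by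
      change LinearMap.trace ℂ ℂ 1 = 1
      simp
    rw [FDRep.char_twist, this, mul_one]
  have : Simple L := by
    refine FDRep.simple_of_sum_normSq _ ?_
    simp [hL, l.mul_conj_eq_one]
  have hG : (Nat.card G : ℂ) ≠ 0 := by simp
  have hGi := invertibleOfNonzero hG
  have h := FDRep.char_orthonormal W L
  rw [if_neg] at h
  · simp only [FDRep.char_inv] at h
    simp only [hL] at h
    exact (mul_eq_zero.1 h).resolve_left (inv_ne_zero hG)
  · rintro ⟨i⟩
    apply hW
    have := congrFun (FDRep.char_iso i) 1
    rw [W.char_one, hL, map_one] at this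
    exact_mod_cast this

theorem FDRep.exists_character_eq [Simple V] (hq : 3 ≤ Fintype.card F)
    (hV : finrank ℂ V = Fintype.card F) :
    ∃ l : GL (Fin 2) F →* ℂ, ∀ g, V.character g = l g * (flagChar g - 1) := by
  obtain ⟨ψ, hψ⟩ := V.exists_character_borelGL hq hV
  let l : GL (Fin 2) F →* ℂ := ψ.comp GeneralLinearGroup.det
  have hB (g : borelGL F) : V.character g = l g * (flagChar (g : GL (Fin 2) F) - 1) := hψ g g.2
  have hl := l.mul_conj_eq_one
  have hlc (g y : GL (Fin 2) F) : l (y * g * y⁻¹) = l g := by simp [l]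
  refine ⟨l, ?_⟩
  set h : GL (Fin 2) F → ℂ := fun g => V.character g - l g * (flagChar g - 1) with hh
  have hV2 : ∑ g, V.character g * conj (V.character g) = Fintype.card (GL (Fin 2) F) := by
    simp only [Complex.mul_conj, ← Complex.ofReal_sum, V.sum_normSq_char]
    simp
  have hV1 : ∑ g, V.character g * conj (l g) = 0 := V.sum_char_mul_eq_zero (by omega) l
  have hV1' : ∑ g, conj (V.character g) * l g = 0 := by
    have := congrArg conj hV1
    simpa using this
  have hV3 : ∑ g, flagChar g * (V.character g * conj (l g)) = Fintype.card (GL (Fin 2) F) := by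
    rw [sum_flagChar_mul fun g y => by rw [V.char_conj, hlc]]
    have h1 (g : borelGL F) : V.character g * conj (l g) = flagChar (g : GL (Fin 2) F) - 1 := by
      rw [hB]
      linear_combination (flagChar (g : GL (Fin 2) F) - 1) * hl g
    simp only [h1, Finset.sum_sub_distrib, sum_borelGL_flagChar, card_GL_two, Finset.sum_const,
      Finset.card_univ, nsmul_eq_mul]
    push_cast
    ring
  have hV4 : ∑ g, flagChar g * (l g * conj (h g)) = 0 := by
    rw [sum_flagChar_mul fun g y => by simp only [hh, V.char_conj, hlc, flagChar_conj]]
    simp [hh, hB]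
  have hsum : ∑ g, Complex.normSq (h g) = 0 := by
    have : ∑ g, h g * conj (h g) = 0 := by
      calc ∑ g, h g * conj (h g) = ∑ g, (V.character g * conj (V.character g)
              - flagChar g * (V.character g * conj (l g)) + V.character g * conj (l g)
              - flagChar g * (l g * conj (h g)) + conj (V.character g) * l g
              - flagChar g + 1) := by
            refine Finset.sum_congr rfl fun g _ => ?_
            simp only [hh, map_sub, map_mul, map_one, conj_flagChar]
            linear_combination (1 - flagChar g) * hl g
        _ = 0 := by
            simp only [Finset.sum_add_distrib, Finset.sum_sub_distrib, hV1, hV1', hV2, hV3, hV4,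
              sum_flagChar]
            simp
    simp only [Complex.mul_conj] at this
    exact_mod_cast this
  intro g
  have := (Finset.sum_eq_zero_iff_of_nonneg fun g _ => Complex.normSq_nonneg _).1 hsum g
    (Finset.mem_univ g)
  exact sub_eq_zero.1 (Complex.normSq_eq_zero.1 this)

end SmallDegrees

end Preliminaries

/-- For `q ≥ 3` a prime power, if `τ` is an irreducible complex representation of `GL₂(q)`
of dimension `q` and `σ` one of dimension `q + 1`, then some irreducible representation
`σ'` of dimension `q + 1` occurs in `τ ⊗ σ` with multiplicity exactly `2`; in particular
`τ ⊗ σ` is not multiplicity free. -/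
theorem tensor_q_q_add_one_not_multFree (q : ℕ) (hq : 3 ≤ q)
    (F : Type) [Field F] [Fintype F] (hF : Fintype.card F = q)
    (τ σ : FDRep ℂ (Matrix.GeneralLinearGroup (Fin 2) F)) [Simple τ] [Simple σ]
    (hτ : finrank ℂ τ = q) (hσ : finrank ℂ σ = q + 1) :
    (∃ σ' : FDRep ℂ (Matrix.GeneralLinearGroup (Fin 2) F), Simple σ' ∧
        finrank ℂ σ' = q + 1 ∧ finrank ℂ (σ' ⟶ τ ⊗ σ) = 2) ∧
      ¬ (∀ χ : FDRep ℂ (Matrix.GeneralLinearGroup (Fin 2) F), Simple χ →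
          finrank ℂ (χ ⟶ τ ⊗ σ) ≤ 1) := by
  classical
  subst hF
  obtain ⟨l, hl⟩ := τ.exists_character_eq hq hτ
  have h : finrank ℂ (σ.twist l ⟶ τ ⊗ σ) = 2 := by
    have hG : (Nat.card (Matrix.GeneralLinearGroup (Fin 2) F) : ℂ) ≠ 0 := by simp
    have hGi := invertibleOfNonzero hG
    have h1 := FDRep.scalar_product_char_eq_finrank_equivariant (σ.twist l) (τ ⊗ σ)
    have h2 (g) : (τ ⊗ σ).character g * (σ.twist l).character g⁻¹ =
        flagChar g * (Complex.normSq (σ.character g) : ℂ) - Complex.normSq (σ.character g) := by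
      rw [FDRep.char_tensor, Pi.mul_apply, FDRep.char_inv, FDRep.char_twist, map_mul, hl,
        ← Complex.mul_conj]
      linear_combination (flagChar g - 1) * σ.character g * (starRingEnd ℂ) (σ.character g) *
        l.mul_conj_eq_one g
    have h3 := sum_flagChar_mul (h := fun g => (Complex.normSq (σ.character g) : ℂ))
      fun g y => by rw [σ.char_conj]
    rw [← Complex.ofReal_sum, σ.sum_borelGL_normSq_char hq hσ] at h3
    simp only [h2, Finset.sum_sub_distrib, h3, ← Complex.ofReal_sum, σ.sum_normSq_char] at h1
    have h4 : (finrank ℂ (σ.twist l ⟶ τ ⊗ σ) : ℂ) = 2 := by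
      rw [← h1, inv_mul_eq_iff_eq_mul₀ hG, Nat.card_eq_fintype_card, card_GL_two]
      push_cast
      ring
    exact_mod_cast h4
  have hsimple := σ.simple_twist l
  refine ⟨⟨σ.twist l, hsimple, hσ, h⟩, fun h' => ?_⟩
  have := h' _ hsimple
  omega
end
end

section
/- Let q ≥ 3 be a prime power, let σ be an irreducible complex representation of GL₂(q) with dim σ = q + 1, and let τ be an irreducible complex representation of GL₂(q) with dim τ = q − 1. Then the tensor product σ ⊗ τ is multiplicity free and contains no one-dimensional subrepresentation. -/
open CategoryTheory Module MonoidalCategory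

noncomputable section

namespace GLTwo

open Matrix

variable {F : Type} [Field F]

/-- The upper unipotent matrix with off-diagonal entry `x`. -/
def upperUnipotent (x : F) : GL (Fin 2) F :=
  GeneralLinearGroup.mkOfDetNeZero !![1, x; 0, 1] (by simp)

/-- The diagonal matrix with entries `a` and `d`. -/
def diagonal (a d : Fˣ) : GL (Fin 2) F :=
  GeneralLinearGroup.mkOfDetNeZero !![(a : F), 0; 0, (d : F)] (by simp)

/-- The lower unipotent matrix with off-diagonal entry `x`. -/
def lowerUnipotent (x : F) : GL (Fin 2) F :=
  GeneralLinearGroup.mkOfDetNeZero !![1, 0; x, 1] (by simp)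

/-- The permutation matrix exchanging the two basis vectors. -/
def weyl : GL (Fin 2) F :=
  GeneralLinearGroup.mkOfDetNeZero !![0, 1; 1, 0] (by simp)

/-- The anti-involution of `GL₂` exchanging the diagonal entries. -/
def flip (g : GL (Fin 2) F) : GL (Fin 2) F :=
  GeneralLinearGroup.mkOfDetNeZero !![g 1 1, g 0 1; g 1 0, g 0 0] (by
    have h := g.det_ne_zero
    rw [det_fin_two] at h ⊢
    simpa [mul_comm] using h)

@[simp] lemma coe_upperUnipotent (x : F) :
    (upperUnipotent x : Matrix (Fin 2) (Fin 2) F) = !![1, x; 0, 1] := rfl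

@[simp] lemma coe_diagonal (a d : Fˣ) :
    (diagonal a d : Matrix (Fin 2) (Fin 2) F) = !![(a : F), 0; 0, (d : F)] := rfl

@[simp] lemma coe_lowerUnipotent (x : F) :
    (lowerUnipotent x : Matrix (Fin 2) (Fin 2) F) = !![1, 0; x, 1] := rfl

@[simp] lemma coe_weyl : ((weyl : GL (Fin 2) F) : Matrix (Fin 2) (Fin 2) F) = !![0, 1; 1, 0] := rfl

@[simp] lemma coe_flip (g : GL (Fin 2) F) :
    (flip g : Matrix (Fin 2) (Fin 2) F) = !![g 1 1, g 0 1; g 1 0, g 0 0] := rfl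

lemma ext_entries {g h : GL (Fin 2) F} (h00 : g 0 0 = h 0 0) (h01 : g 0 1 = h 0 1)
    (h10 : g 1 0 = h 1 0) (h11 : g 1 1 = h 1 1) : g = h := by
  ext i j
  fin_cases i <;> fin_cases j <;> assumption

lemma upperUnipotent_zero : upperUnipotent (0 : F) = 1 := by
  apply ext_entries <;> simp

lemma upperUnipotent_add (x y : F) :
    upperUnipotent (x + y) = upperUnipotent x * upperUnipotent y := by
  apply ext_entries <;> simp [Matrix.mul_apply, add_comm]

lemma diagonal_mul (a b c d : Fˣ) : diagonal a b * diagonal c d = diagonal (a * c) (b * d) := by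
  apply ext_entries <;> simp [Matrix.mul_apply]

lemma diagonal_one : diagonal (1 : Fˣ) 1 = 1 := by
  apply ext_entries <;> simp

lemma upperUnipotent_mul_diagonal (x : F) (a d : Fˣ) :
    upperUnipotent x * diagonal a d = diagonal a d * upperUnipotent (x * d / a) := by
  apply ext_entries <;> simp [Matrix.mul_apply]
  field_simp

lemma diagonal_scalar_comm (z : Fˣ) (g : GL (Fin 2) F) :
    diagonal z z * g = g * diagonal z z := by
  apply ext_entries <;> simp [Matrix.mul_apply, mul_comm]

lemma weyl_conj (x : F) : weyl * upperUnipotent x * weyl = lowerUnipotent x := by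
  apply ext_entries <;> simp [Matrix.mul_apply]

lemma weyl_mul_weyl : weyl * weyl = (1 : GL (Fin 2) F) := by
  apply ext_entries <;> simp [Matrix.mul_apply]

lemma flip_mul (g h : GL (Fin 2) F) : flip (g * h) = flip h * flip g := by
  apply ext_entries <;> simp [Matrix.mul_apply] <;> ring

lemma flip_upperUnipotent (x : F) : flip (upperUnipotent x) = upperUnipotent x := by
  apply ext_entries <;> simp

lemma flip_eq_of_ne_zero {g : GL (Fin 2) F} (hg : g 1 0 ≠ 0) :
    flip g = upperUnipotent ((g 1 1 - g 0 0) / g 1 0) * g *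
      upperUnipotent (-((g 1 1 - g 0 0) / g 1 0)) := by
  apply ext_entries <;>
    simp [Matrix.mul_apply, Matrix.vecMul, dotProduct, Fin.sum_univ_two] <;> field_simp <;> ring

lemma det_eq (g : GL (Fin 2) F) : g 0 0 * g 1 1 - g 0 1 * g 1 0 ≠ 0 := by
  have h := g.det_ne_zero
  rwa [det_fin_two] at h

lemma exists_eq_diagonal_mul_upperUnipotent {g : GL (Fin 2) F} (hg : g 1 0 = 0) :
    ∃ (a d : Fˣ) (x : F), g = diagonal a d * upperUnipotent x := by
  have h := det_eq g
  rw [hg, mul_zero, sub_zero, mul_ne_zero_iff] at h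
  refine ⟨Units.mk0 _ h.1, Units.mk0 _ h.2, g 0 1 / g 0 0, ?_⟩
  apply ext_entries <;> simp [Matrix.mul_apply, hg]
  field_simp [h.1]

lemma exists_eq_lowerUnipotent_mul {g : GL (Fin 2) F} (hg : g 0 0 ≠ 0) :
    ∃ (x : F) (b : GL (Fin 2) F), b 1 0 = 0 ∧ g = lowerUnipotent x * b := by
  refine ⟨g 1 0 / g 0 0, lowerUnipotent (-(g 1 0 / g 0 0)) * g, ?_, ?_⟩
  · simp [Matrix.mul_apply]
    field_simp
    ring
  · rw [← mul_assoc]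
    convert (one_mul g).symm using 2
    apply ext_entries <;> simp [Matrix.mul_apply]


section Representation

variable [Fintype F] {V : Type*} [AddCommGroup V] [Module ℂ V]
  (ρ : Representation ℂ (GL (Fin 2) F) V)

/-- A submodule stable under a representation is trivial or everything. -/
def NoInvariant {G V : Type*} [Group G] [AddCommGroup V] [Module ℂ V]
    (ρ : Representation ℂ G V) : Prop :=
  ∀ W : Submodule ℂ V, (∀ g, ∀ v ∈ W, ρ g v ∈ W) → W = ⊥ ∨ W = ⊤

/-- In a representation without proper invariant subspaces, the orbit of a nonzero vector spans. -/
lemma NoInvariant.span_orbit {G V : Type*} [Group G] [AddCommGroup V] [Module ℂ V]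
    {ρ : Representation ℂ G V} (h : NoInvariant ρ) {v : V} (hv : v ≠ 0) :
    Submodule.span ℂ (Set.range fun g => ρ g v) = ⊤ := by
  refine (h _ fun g w hw => ?_).resolve_left fun hbot => hv ?_
  · induction hw using Submodule.span_induction with
    | mem x hx =>
      obtain ⟨k, rfl⟩ := hx
      refine Submodule.subset_span ⟨g * k, ?_⟩
      simp
    | zero => simp
    | add x y _ _ hx hy => simpa using Submodule.add_mem _ hx hy
    | smul c x _ hx => simpa using Submodule.smul_mem _ c hx
  · have : v ∈ Submodule.span ℂ (Set.range fun g => ρ g v) :=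
      Submodule.subset_span ⟨1, by simp⟩
    simpa [hbot] using this

/-- An operator commuting with a representation without proper invariant subspaces is a scalar. -/
lemma NoInvariant.exists_smul {G V : Type*} [Group G] [AddCommGroup V] [Module ℂ V]
    [FiniteDimensional ℂ V] {ρ : Representation ℂ G V} (h : NoInvariant ρ) (A : V →ₗ[ℂ] V)
    (hA : ∀ g v, A (ρ g v) = ρ g (A v)) : ∃ c : ℂ, ∀ v, A v = c • v := by
  cases subsingleton_or_nontrivial V
  · exact ⟨0, fun v => Subsingleton.elim _ _⟩
  obtain ⟨c, hc⟩ := Module.End.exists_eigenvalue A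
  refine ⟨c, fun v => ?_⟩
  have : Module.End.eigenspace A c = ⊤ := by
    refine (h _ fun g v hv => ?_).resolve_left hc
    rw [Module.End.mem_eigenspace_iff] at hv ⊢
    rw [hA, hv, map_smul]
  rw [← Module.End.mem_eigenspace_iff, this]
  trivial

/-- The operators of a representation of a group are injective. -/
lemma rho_ne_zero {G V : Type*} [Group G] [AddCommGroup V] [Module ℂ V]
    {ρ : Representation ℂ G V} {v : V} (hv : v ≠ 0) (g : G) : ρ g v ≠ 0 := by
  intro h0
  apply hv
  have := congrArg (ρ g⁻¹) h0
  rwa [← Module.End.mul_apply, ← map_mul, inv_mul_cancel, map_one, map_zero] at this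

lemma finrank_span_singleton_le_one {V : Type*} [AddCommGroup V] [Module ℂ V] (v : V) :
    finrank ℂ (Submodule.span ℂ {v}) ≤ 1 := by
  simpa using finrank_span_le_card (R := ℂ) ({v} : Set V)

/-- A fixed primitive additive character of `F`. -/
abbrev psi (F : Type) [Field F] [Fintype F] : AddChar F ℂ :=
  AddChar.FiniteField.primitiveChar_to_Complex F

lemma exists_psi_ne {a b : F} (hab : a ≠ b) : ∃ x : F, psi F (a * x) ≠ psi F (b * x) := by
  have h := AddChar.FiniteField.primitiveChar_to_Complex_isPrimitive F (sub_ne_zero.2 hab)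
  rw [AddChar.ne_one_iff] at h
  obtain ⟨x, hx⟩ := h
  refine ⟨x, fun he => hx ?_⟩
  rw [AddChar.mulShift_apply, sub_mul, AddChar.map_sub_eq_div, he, div_self]
  exact (AddChar.val_isUnit _ _).ne_zero

/-- The vectors on which the unipotent group acts through the character `x ↦ psi (a * x)`. -/
def whittaker (a : F) : Submodule ℂ V where
  carrier := {v | ∀ x, ρ (upperUnipotent x) v = psi F (a * x) • v}
  add_mem' {v w} hv hw x := by simp only [map_add, hv x, hw x, smul_add]
  zero_mem' x := by simp
  smul_mem' c v hv x := by simp only [map_smul, hv x, smul_comm c]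

lemma mem_whittaker {ρ : Representation ℂ (GL (Fin 2) F) V} {a : F} {v : V} :
    v ∈ whittaker ρ a ↔ ∀ x, ρ (upperUnipotent x) v = psi F (a * x) • v := Iff.rfl

/-- The projection onto `whittaker ρ a`. -/
def proj (a : F) : V →ₗ[ℂ] V :=
  (Fintype.card F : ℂ)⁻¹ • ∑ x, psi F (-(a * x)) • ρ (upperUnipotent x)

lemma proj_apply (a : F) (v : V) :
    proj ρ a v = (Fintype.card F : ℂ)⁻¹ • ∑ x, psi F (-(a * x)) • ρ (upperUnipotent x) v := by
  simp [proj]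

lemma proj_eq_self {a : F} {v : V} (hv : v ∈ whittaker ρ a) : proj ρ a v = v := by
  rw [proj_apply]
  simp_rw [mem_whittaker.1 hv, smul_smul, ← AddChar.map_add_eq_mul]
  simp [← Nat.cast_smul_eq_nsmul ℂ, smul_smul]

lemma rho_proj (a x : F) (v : V) :
    ρ (upperUnipotent x) (proj ρ a v) = psi F (a * x) • proj ρ a v := by
  rw [proj_apply, map_smul, smul_comm (psi F (a * x)), map_sum]
  congr 1
  rw [Finset.smul_sum]
  refine Fintype.sum_equiv (Equiv.addLeft x) _ _ fun y => ?_
  rw [map_smul, smul_smul, ← AddChar.map_add_eq_mul, Equiv.coe_addLeft, upperUnipotent_add,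
    map_mul, Module.End.mul_apply]
  congr 2
  ring

lemma proj_rho (a x : F) (v : V) :
    proj ρ a (ρ (upperUnipotent x) v) = psi F (a * x) • proj ρ a v := by
  rw [← rho_proj, proj_apply, proj_apply, (ρ (upperUnipotent x)).map_smul, map_sum (ρ _)]
  congr 1
  refine Finset.sum_congr rfl fun y _ => ?_
  rw [map_smul, ← Module.End.mul_apply (ρ _), ← Module.End.mul_apply (ρ _), ← map_mul ρ,
    ← map_mul ρ, ← upperUnipotent_add, ← upperUnipotent_add, add_comm]

lemma proj_mem (a : F) (v : V) : proj ρ a v ∈ whittaker ρ a := fun x => rho_proj ρ a x v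

lemma proj_eq_zero {a b : F} (hab : a ≠ b) {v : V} (hv : v ∈ whittaker ρ b) :
    proj ρ a v = 0 := by
  obtain ⟨x, hx⟩ := exists_psi_ne hab
  have h := proj_rho ρ a x v
  rw [mem_whittaker.1 hv, map_smul, ← sub_eq_zero, ← sub_smul, smul_eq_zero] at h
  exact h.resolve_left (sub_ne_zero.2 hx.symm)

lemma sum_proj (v : V) : ∑ a, proj ρ a v = v := by
  classical
  simp_rw [proj_apply]
  rw [← Finset.smul_sum, Finset.sum_comm]
  simp_rw [← Finset.sum_smul]
  have h (x : F) : ∑ a : F, psi F (-(a * x)) = if x = 0 then (Fintype.card F : ℂ) else 0 := by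
    have := AddChar.sum_mulShift (-x) (AddChar.FiniteField.primitiveChar_to_Complex_isPrimitive F)
    simpa using this
  simp [h, ite_smul, upperUnipotent_zero, smul_smul]

/-- The compression of the action to the Whittaker space. -/
def bessel (a : F) (g : GL (Fin 2) F) : V →ₗ[ℂ] V := proj ρ a ∘ₗ ρ g ∘ₗ proj ρ a

lemma bessel_apply (a : F) (g : GL (Fin 2) F) (v : V) :
    bessel ρ a g v = proj ρ a (ρ g (proj ρ a v)) := rfl

lemma bessel_left (a x : F) (g : GL (Fin 2) F) (v : V) :
    bessel ρ a (upperUnipotent x * g) v = psi F (a * x) • bessel ρ a g v := by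
  rw [bessel_apply, map_mul, Module.End.mul_apply, proj_rho, bessel_apply]

lemma bessel_right (a x : F) (g : GL (Fin 2) F) (v : V) :
    bessel ρ a (g * upperUnipotent x) v = psi F (a * x) • bessel ρ a g v := by
  rw [bessel_apply, map_mul, Module.End.mul_apply, rho_proj, map_smul, map_smul, bessel_apply]

lemma bessel_diagonal {a : F} (ha : a ≠ 0) {c d : Fˣ} (hcd : c ≠ d) (v : V) :
    bessel ρ a (diagonal c d) v = 0 := by
  have hne : a ≠ a * (d / c) := by
    intro h
    apply hcd
    ext
    field_simp at h
    exact h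
  obtain ⟨x, hx⟩ := exists_psi_ne hne
  have h := bessel_left ρ a x (diagonal c d) v
  rw [upperUnipotent_mul_diagonal, bessel_right, ← sub_eq_zero, ← sub_smul, smul_eq_zero] at h
  refine h.resolve_left (sub_ne_zero.2 fun he => hx ?_)
  rw [← he]
  congr 1
  ring

lemma bessel_flip {a : F} (ha : a ≠ 0) (g : GL (Fin 2) F) (v : V) :
    bessel ρ a (flip g) v = bessel ρ a g v := by
  by_cases hg : g 1 0 = 0
  · obtain ⟨c, d, x, rfl⟩ := exists_eq_diagonal_mul_upperUnipotent hg
    have hf : flip (diagonal c d) = diagonal d c := by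
      apply ext_entries <;> simp
    rw [flip_mul, flip_upperUnipotent, hf, bessel_left, bessel_right]
    by_cases hcd : c = d
    · rw [hcd]
    · rw [bessel_diagonal ρ ha hcd, bessel_diagonal ρ ha (Ne.symm hcd)]
  · rw [flip_eq_of_ne_zero hg, bessel_right, bessel_left, smul_smul, ← AddChar.map_add_eq_mul]
    simp

lemma bessel_bessel (a : F) (g h : GL (Fin 2) F) (v : V) :
    bessel ρ a g (bessel ρ a h v) = (Fintype.card F : ℂ)⁻¹ •
      ∑ x, psi F (-(a * x)) • bessel ρ a (g * upperUnipotent x * h) v := by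
  rw [bessel_apply, bessel_apply, proj_eq_self ρ (proj_mem ρ _ _),
    proj_apply ρ a (ρ h _), map_smul, map_smul, map_sum, map_sum]
  simp only [map_smul, bessel_apply, map_mul, Module.End.mul_apply]

lemma bessel_comm {a : F} (ha : a ≠ 0) (g h : GL (Fin 2) F) (v : V) :
    bessel ρ a g (bessel ρ a h v) = bessel ρ a h (bessel ρ a g v) := by
  rw [← bessel_flip ρ ha h (bessel ρ a g v), ← bessel_flip ρ ha g v, bessel_bessel, bessel_bessel]
  congr 1
  refine Finset.sum_congr rfl fun x _ => ?_
  rw [← bessel_flip ρ ha, flip_mul, flip_mul, flip_upperUnipotent, ← mul_assoc]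

variable {ρ}

/-- Each compressed operator acts on the Whittaker space by a scalar. -/
lemma exists_bessel_eq_smul [FiniteDimensional ℂ V] (h : NoInvariant ρ) {a : F} (ha : a ≠ 0)
    (g : GL (Fin 2) F) : ∃ c : ℂ, ∀ v ∈ whittaker ρ a, bessel ρ a g v = c • v := by
  cases subsingleton_or_nontrivial (whittaker ρ a) with
  | inl hs =>
    refine ⟨0, fun v hv => ?_⟩
    have : v = 0 := congrArg Subtype.val (Subsingleton.elim (⟨v, hv⟩ : whittaker ρ a) 0)
    simp [this]
  | inr hn =>
    have hmaps : ∀ v ∈ whittaker ρ a, bessel ρ a g v ∈ whittaker ρ a :=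
      fun v _ => proj_mem ρ a _
    obtain ⟨c, hc⟩ := Module.End.exists_eigenvalue ((bessel ρ a g).restrict hmaps)
    obtain ⟨⟨v, hv⟩, hv'⟩ := hc.exists_hasEigenvector
    have hv0 : v ≠ 0 := fun h0 => hv'.2 (Subtype.ext h0)
    have hgv : bessel ρ a g v = c • v := congrArg Subtype.val hv'.apply_eq_smul
    have key (y : V) : bessel ρ a g (proj ρ a y) = c • proj ρ a y := by
      have hy : y ∈ Submodule.span ℂ (Set.range fun k => ρ k v) := by
        rw [h.span_orbit hv0]; trivial
      induction hy using Submodule.span_induction with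
      | mem x hx =>
        obtain ⟨k, rfl⟩ := hx
        have hk : proj ρ a (ρ k v) = bessel ρ a k v := by rw [bessel_apply, proj_eq_self ρ hv]
        simp only [hk]
        rw [bessel_comm ρ ha, hgv, map_smul]
      | zero => simp
      | add x y _ _ hx hy => simp only [map_add, hx, hy, smul_add]
      | smul d x _ hx => simp only [map_smul, hx, smul_comm c]
    exact ⟨c, fun w hw => by rw [← proj_eq_self ρ hw, key]⟩

/-- Uniqueness of Whittaker vectors. -/
lemma exists_eq_smul_of_mem_whittaker [FiniteDimensional ℂ V] (h : NoInvariant ρ) {a : F}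
    (ha : a ≠ 0) {v w : V} (hv : v ∈ whittaker ρ a) (hv0 : v ≠ 0) (hw : w ∈ whittaker ρ a) :
    ∃ c : ℂ, c • v = w := by
  rw [← Submodule.mem_span_singleton, ← proj_eq_self ρ hw]
  have hy : w ∈ Submodule.span ℂ (Set.range fun k => ρ k v) := by
    rw [h.span_orbit hv0]; trivial
  clear hw
  induction hy using Submodule.span_induction with
  | mem x hx =>
    obtain ⟨k, rfl⟩ := hx
    obtain ⟨c, hc⟩ := exists_bessel_eq_smul h ha k
    have hk : proj ρ a (ρ k v) = bessel ρ a k v := by rw [bessel_apply, proj_eq_self ρ hv]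
    simp only [hk]
    exact Submodule.mem_span_singleton.2 ⟨c, (hc v hv).symm⟩
  | zero => simp
  | add x y _ _ hx hy => simpa using Submodule.add_mem _ hx hy
  | smul d x _ hx => simpa using Submodule.smul_mem _ d hx

lemma exists_whittaker_le_span [FiniteDimensional ℂ V] (h : NoInvariant ρ) {a : F} (ha : a ≠ 0) :
    ∃ v ∈ whittaker ρ a, whittaker ρ a ≤ Submodule.span ℂ {v} := by
  by_cases hb : whittaker ρ a = ⊥
  · exact ⟨0, Submodule.zero_mem _, by simp [hb]⟩
  · obtain ⟨v, hv, hv0⟩ := Submodule.exists_mem_ne_zero_of_ne_bot hb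
    exact ⟨v, hv, fun w hw => Submodule.mem_span_singleton.2
      (exists_eq_smul_of_mem_whittaker h ha hv hv0 hw)⟩

lemma finrank_whittaker_le_one [FiniteDimensional ℂ V] (h : NoInvariant ρ) {a : F} (ha : a ≠ 0) :
    finrank ℂ (whittaker ρ a) ≤ 1 := by
  obtain ⟨v, -, hle⟩ := exists_whittaker_le_span h ha
  exact (Submodule.finrank_mono hle).trans (finrank_span_singleton_le_one v)

lemma diagonal_mem_whittaker {a : F} {v : V} (hv : v ∈ whittaker ρ a) (c d : Fˣ) :
    ρ (diagonal c d) v ∈ whittaker ρ (a * d / c) := by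
  intro x
  rw [← Module.End.mul_apply, ← map_mul, upperUnipotent_mul_diagonal, map_mul,
    Module.End.mul_apply, mem_whittaker.1 hv, map_smul]
  congr 2
  ring

/-- A representation with unipotent invariants contains an eigenvector of the Borel subgroup. -/
lemma exists_borel_eigenvector [FiniteDimensional ℂ V] (h : NoInvariant ρ)
    (h0 : whittaker ρ 0 ≠ ⊥) :
    ∃ v ∈ whittaker ρ 0, v ≠ 0 ∧ ∀ g : GL (Fin 2) F, g 1 0 = 0 → ∃ c : ℂ, ρ g v = c • v := by
  obtain ⟨t, ht⟩ := IsCyclic.exists_generator (α := Fˣ)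
  have hmaps : ∀ v ∈ whittaker ρ 0, ρ (diagonal t 1) v ∈ whittaker ρ 0 :=
    fun v hv => by simpa using diagonal_mem_whittaker hv t 1
  have : Nontrivial (whittaker ρ 0) := Submodule.nontrivial_iff_ne_bot.2 h0
  obtain ⟨c, hc⟩ := Module.End.exists_eigenvalue ((ρ (diagonal t 1)).restrict hmaps)
  obtain ⟨⟨v, hv⟩, hv'⟩ := hc.exists_hasEigenvector
  have hv0 : v ≠ 0 := fun h0 => hv'.2 (Subtype.ext h0)
  have htv : ρ (diagonal t 1) v = c • v := congrArg Subtype.val hv'.apply_eq_smul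
  have hpow (n : ℕ) : ρ (diagonal (t ^ n) 1) v = c ^ n • v := by
    induction n with
    | zero => simp [diagonal_one]
    | succ n ih =>
      rw [pow_succ, ← one_mul (1 : Fˣ), ← diagonal_mul, map_mul, Module.End.mul_apply, htv,
        map_smul, ih, smul_smul, pow_succ, mul_comm]
  refine ⟨v, hv, hv0, fun g hg => ?_⟩
  obtain ⟨a, d, x, rfl⟩ := exists_eq_diagonal_mul_upperUnipotent hg
  obtain ⟨z, hz⟩ := h.exists_smul (ρ (diagonal d d)) fun g w => by
    rw [← Module.End.mul_apply, ← map_mul, diagonal_scalar_comm, map_mul, Module.End.mul_apply]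
  obtain ⟨n, hn⟩ := mem_powers_iff_mem_zpowers.2 (ht (a / d))
  have hsplit : diagonal a d = diagonal d d * diagonal (t ^ n) 1 := by
    rw [show t ^ n = a / d from hn, diagonal_mul]
    simp
  refine ⟨z * c ^ n, ?_⟩
  rw [map_mul, Module.End.mul_apply, mem_whittaker.1 hv, hsplit, map_mul, Module.End.mul_apply]
  simp [hpow, hz, smul_smul, mul_comm]

/-- If the unipotent group acts trivially, then the representation is at most one-dimensional. -/
lemma finrank_le_one_of_whittaker_zero_eq_top [FiniteDimensional ℂ V] (h : NoInvariant ρ)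
    (h0 : whittaker ρ 0 = ⊤) : finrank ℂ V ≤ 1 := by
  cases subsingleton_or_nontrivial V
  · simp [finrank_zero_of_subsingleton]
  obtain ⟨v, hv, hv0, hB⟩ := exists_borel_eigenvector h (by rw [h0]; exact top_ne_bot)
  have hU (x : F) (w : V) : ρ (upperUnipotent x) w = w := by
    have hw : w ∈ whittaker ρ 0 := by rw [h0]; trivial
    simpa using hw x
  have hL (x : F) (w : V) : ρ (lowerUnipotent x) w = w := by
    rw [← weyl_conj, map_mul, map_mul, Module.End.mul_apply, Module.End.mul_apply, hU,
      ← Module.End.mul_apply, ← map_mul, weyl_mul_weyl, map_one, Module.End.one_apply]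
  have hG' (g : GL (Fin 2) F) (hg : g 0 0 ≠ 0) : ∃ c : ℂ, ρ g v = c • v := by
    obtain ⟨x, b, hb, rfl⟩ := exists_eq_lowerUnipotent_mul hg
    rw [map_mul, Module.End.mul_apply, hL]
    exact hB b hb
  have hG (g : GL (Fin 2) F) : ∃ c : ℂ, ρ g v = c • v := by
    by_cases hg : g 0 0 = 0
    · have h10 : g 1 0 ≠ 0 := fun h10 => det_eq g (by simp [hg, h10])
      rw [← hU 1 (ρ g v), ← Module.End.mul_apply, ← map_mul]
      exact hG' _ (by simpa [Matrix.mul_apply, hg] using h10)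
    · exact hG' g hg
  have hspan : (⊤ : Submodule ℂ V) ≤ Submodule.span ℂ {v} := by
    rw [← h.span_orbit hv0, Submodule.span_le]
    rintro _ ⟨g, rfl⟩
    obtain ⟨c, hc⟩ := hG g
    exact Submodule.mem_span_singleton.2 ⟨c, hc.symm⟩
  rw [← finrank_top ℂ V]
  exact (Submodule.finrank_mono hspan).trans (finrank_span_singleton_le_one v)

/-- An irreducible representation of dimension at least `q` has unipotent invariants. -/
lemma whittaker_zero_ne_bot [FiniteDimensional ℂ V] (h : NoInvariant ρ)
    (hdim : Fintype.card F ≤ finrank ℂ V) : whittaker ρ 0 ≠ ⊥ := by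
  classical
  intro hbot
  choose! x hx hle using fun a : F => exists_whittaker_le_span h (a := a)
  have hspan : (⊤ : Submodule ℂ V) ≤ Submodule.span ℂ (Set.range fun a : Fˣ => x a) := by
    intro v _
    rw [← sum_proj ρ v]
    refine Submodule.sum_mem _ fun a _ => ?_
    by_cases ha : a = 0
    · have := proj_mem ρ a v
      rw [ha, hbot, Submodule.mem_bot] at this
      rw [ha, this]
      exact Submodule.zero_mem _
    · refine Submodule.span_mono ?_ (hle a ha (proj_mem ρ a v))
      rintro _ rfl
      exact ⟨Units.mk0 a ha, rfl⟩
  have h1 := Submodule.finrank_mono hspan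
  have h2 : (Set.range fun a : Fˣ => x a).finrank ℂ ≤ _ := finrank_range_le_card _
  rw [finrank_top] at h1
  rw [Fintype.card_units] at h2
  have h3 : 0 < Fintype.card F := Fintype.card_pos
  rw [Set.finrank] at h2
  omega

lemma diagonal_mem_whittaker_of_ne_zero {b : F} (hb : b ≠ 0) {w : V} (hw : w ∈ whittaker ρ b)
    {a : F} (ha : a ≠ 0) :
    ρ (diagonal (Units.mk0 b hb) (Units.mk0 a ha)) w ∈ whittaker ρ a := by
  simpa [hb] using diagonal_mem_whittaker hw (Units.mk0 b hb) (Units.mk0 a ha)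

lemma whittaker_ne_bot [FiniteDimensional ℂ V] (h : NoInvariant ρ) (hdim : 2 ≤ finrank ℂ V) :
    whittaker ρ 1 ≠ ⊥ := by
  intro hbot
  have hne (a : F) (ha : a ≠ 0) : whittaker ρ a = ⊥ := by
    by_contra hab
    obtain ⟨w, hw, hw0⟩ := Submodule.exists_mem_ne_zero_of_ne_bot hab
    have := diagonal_mem_whittaker_of_ne_zero ha hw one_ne_zero
    rw [hbot, Submodule.mem_bot] at this
    exact rho_ne_zero hw0 _ this
  have := finrank_le_one_of_whittaker_zero_eq_top h (by
    refine eq_top_iff.2 fun v _ => ?_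
    rw [← sum_proj ρ v, Fintype.sum_eq_single 0]
    · exact proj_mem ρ 0 v
    · intro a ha
      have := proj_mem ρ a v
      rwa [hne a ha, Submodule.mem_bot] at this)
  omega

/-- An irreducible representation of dimension less than `q` with Whittaker vectors has no unipotent
invariants. -/
lemma whittaker_zero_eq_bot [FiniteDimensional ℂ V] (h1 : whittaker ρ 1 ≠ ⊥)
    (hdim : finrank ℂ V < Fintype.card F) : whittaker ρ 0 = ⊥ := by
  by_contra h0
  have hne (a : F) : ∃ w ∈ whittaker ρ a, w ≠ 0 := by
    by_cases ha : a = 0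
    · rw [ha]
      exact Submodule.exists_mem_ne_zero_of_ne_bot h0
    · obtain ⟨w, hw, hw0⟩ := Submodule.exists_mem_ne_zero_of_ne_bot h1
      exact ⟨_, diagonal_mem_whittaker_of_ne_zero one_ne_zero hw ha, rho_ne_zero hw0 _⟩
  choose w hw hw0 using hne
  have hli : LinearIndependent ℂ w := by
    rw [Fintype.linearIndependent_iff]
    intro c hc b
    have := congrArg (proj ρ b) hc
    rw [map_sum, map_zero, Fintype.sum_eq_single b, map_smul, proj_eq_self ρ (hw b),
      smul_eq_zero] at this
    · exact this.resolve_right (hw0 b)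
    · intro a hab
      rw [map_smul, proj_eq_zero ρ hab.symm (hw a), smul_zero]
  have := hli.fintype_card_le_finrank
  omega

/-- A one-dimensional representation has no Whittaker vectors. -/
lemma whittaker_eq_bot_of_finrank_eq_one (hF : 3 ≤ Fintype.card F) (h : finrank ℂ V = 1) :
    whittaker ρ 1 = ⊥ := by
  by_contra hne
  obtain ⟨w, hw, hw0⟩ := Submodule.exists_mem_ne_zero_of_ne_bot hne
  have : ∃ a : F, a ≠ 0 ∧ a ≠ 1 := by
    classical
    by_contra! hall
    have : (Finset.univ : Finset F) ⊆ {0, 1} := fun a _ => by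
      by_cases ha : a = 0
      · simp [ha]
      · simp [hall a ha]
    have := (Finset.card_le_card this).trans Finset.card_le_two
    rw [Finset.card_univ] at this
    omega
  obtain ⟨a, ha0, ha1⟩ := this
  have hmem := diagonal_mem_whittaker_of_ne_zero one_ne_zero hw ha0
  obtain ⟨c, hc⟩ := (finrank_eq_one_iff_of_nonzero' w hw0).1 h
    (ρ (diagonal (Units.mk0 1 one_ne_zero) (Units.mk0 a ha0)) w)
  have h1 := proj_eq_zero ρ ha1 hw
  have h2 := proj_eq_self ρ hmem
  rw [← hc, map_smul, h1, smul_zero, hc] at h2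
  exact rho_ne_zero hw0 _ h2.symm

/-- Without unipotent invariants, the diagonal translates of a Whittaker vector span. -/
lemma span_diagonal_eq_top [FiniteDimensional ℂ V] (h : NoInvariant ρ) (h0 : whittaker ρ 0 = ⊥)
    {w : V} (hw : w ∈ whittaker ρ 1) (hw0 : w ≠ 0) :
    Submodule.span ℂ (Set.range fun d : Fˣ => ρ (diagonal 1 d) w) = ⊤ := by
  refine eq_top_iff.2 fun v _ => ?_
  rw [← sum_proj ρ v]
  refine Submodule.sum_mem _ fun a _ => ?_
  have hp := proj_mem ρ a v
  by_cases ha : a = 0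
  · rw [ha, h0, Submodule.mem_bot] at hp
    rw [ha, hp]
    exact Submodule.zero_mem _
  · have hmem : ρ (diagonal 1 (Units.mk0 a ha)) w ∈ whittaker ρ a := by
      simpa using diagonal_mem_whittaker hw 1 (Units.mk0 a ha)
    obtain ⟨c, hc⟩ := exists_eq_smul_of_mem_whittaker h ha hmem (rho_ne_zero hw0 _) hp
    rw [← hc]
    exact Submodule.smul_mem _ _ (Submodule.subset_span ⟨_, rfl⟩)

/-- An equivariant bilinear map is determined by its value at a Borel eigenvector and a Whittaker
vector. -/
lemma bilinear_eq_zero {S X Y : Type*} [AddCommGroup S] [Module ℂ S] [AddCommGroup X] [Module ℂ X]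
    [FiniteDimensional ℂ X] [AddCommGroup Y] [Module ℂ Y]
    {α : Representation ℂ (GL (Fin 2) F) S} {β : Representation ℂ (GL (Fin 2) F) X}
    {γ : Representation ℂ (GL (Fin 2) F) Y} (hα : NoInvariant α) (hβ : NoInvariant β)
    (hβ0 : whittaker β 0 = ⊥) (T : S →ₗ[ℂ] X →ₗ[ℂ] Y)
    (hT : ∀ g s x, T (α g s) (β g x) = γ g (T s x)) {v : S} (hv0 : v ≠ 0)
    (hB : ∀ g : GL (Fin 2) F, g 1 0 = 0 → ∃ c : ℂ, α g v = c • v)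
    {w : X} (hw : w ∈ whittaker β 1) (hw0 : w ≠ 0) (h0 : T v w = 0) : T = 0 := by
  have hTv : T v = 0 := by
    refine LinearMap.ext_on_range (span_diagonal_eq_top hβ hβ0 hw hw0) fun d => ?_
    obtain ⟨c, hc⟩ := hB (diagonal 1 d) (by simp)
    have hc0 : c ≠ 0 := by
      rintro rfl
      exact rho_ne_zero hv0 _ (hc.trans (zero_smul _ _))
    have := hT (diagonal 1 d) v w
    rw [h0, map_zero, hc, map_smul, LinearMap.smul_apply, smul_eq_zero] at this
    exact this.resolve_left hc0
  refine LinearMap.ext_on_range (hα.span_orbit hv0) fun g => LinearMap.ext fun x => ?_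
  have hx : x = β g (β g⁻¹ x) := by
    rw [← Module.End.mul_apply, ← map_mul, mul_inv_cancel, map_one, Module.End.one_apply]
  rw [hx, hT, hTv]
  simp

end Representation
end GLTwo

section FDRep

open scoped TensorProduct

variable {G : Type} [Group G]

/-- The linear map underlying a morphism of representations. -/
def FDRep.toLin (A B : FDRep ℂ G) : (A ⟶ B) →ₗ[ℂ] (A →ₗ[ℂ] B) where
  toFun f := f.hom.hom.hom
  map_add' _ _ := rfl
  map_smul' _ _ := rfl

lemma FDRep.toLin_injective (A B : FDRep ℂ G) : Function.Injective (FDRep.toLin A B) := by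
  intro f g h
  apply Action.Hom.ext
  apply InducedCategory.hom_ext
  exact ModuleCat.hom_ext h

lemma FDRep.toLin_rho {A B : FDRep ℂ G} (f : A ⟶ B) (g : G) (v : A) :
    FDRep.toLin A B f (A.ρ g v) = B.ρ g (FDRep.toLin A B f v) :=
  ConcreteCategory.congr_hom (f.comm g) v

/-- A simple object has no proper invariant subspaces. -/
lemma FDRep.noInvariant (A : FDRep ℂ G) [Simple A] : GLTwo.NoInvariant A.ρ := by
  intro W hW
  let ρW : Representation ℂ G W :=
    { toFun g := (A.ρ g).restrict (hW g)
      map_one' := by ext; simp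
      map_mul' g h := by ext; simp }
  let i : FDRep.of ρW ⟶ A :=
    { hom := InducedCategory.homMk (ModuleCat.ofHom W.subtype)
      comm g := by
        apply InducedCategory.hom_ext
        rfl }
  have hi : Function.Injective (FDRep.toLin _ _ i) := W.injective_subtype
  have : Mono i := by
    refine ⟨fun f g h => FDRep.toLin_injective _ _ (LinearMap.ext fun v => hi ?_)⟩
    exact LinearMap.congr_fun (congrArg (FDRep.toLin _ _) h) v
  by_cases h0 : i = 0
  · left
    refine (Submodule.eq_bot_iff _).2 fun w hw => ?_
    exact LinearMap.congr_fun (congrArg (FDRep.toLin _ _) h0) ⟨w, hw⟩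
  · right
    have : IsIso i := isIso_of_mono_of_nonzero h0
    refine eq_top_iff.2 fun v _ => ?_
    have := LinearMap.congr_fun (congrArg (FDRep.toLin _ _) (IsIso.inv_hom_id i)) v
    have h2 : FDRep.toLin _ _ i (FDRep.toLin _ _ (inv i) v) = v := this
    rw [← h2]
    exact (FDRep.toLin _ _ (inv i) v : W).2

lemma FDRep.finrank_hom_comm [Finite G] (A B : FDRep ℂ G) :
    finrank ℂ (A ⟶ B) = finrank ℂ (B ⟶ A) := by
  have := Fintype.ofFinite G
  have : Invertible (Nat.card G : ℂ) := invertibleOfNonzero (by simp)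
  rw [← Nat.cast_inj (R := ℂ), ← FDRep.scalar_product_char_eq_finrank_equivariant,
    ← FDRep.scalar_product_char_eq_finrank_equivariant]
  congr 1
  refine Fintype.sum_equiv (Equiv.inv G) _ _ fun g => ?_
  simp [mul_comm]

/-- The bilinear map underlying a morphism out of a tensor product. -/
def FDRep.toBilin (A B C : FDRep ℂ G) : (A ⊗ B ⟶ C) →ₗ[ℂ] (A →ₗ[ℂ] B →ₗ[ℂ] C) :=
  (TensorProduct.lift.equiv (.id ℂ) A B C).symm.toLinearMap ∘ₗ FDRep.toLin (A ⊗ B) C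

lemma FDRep.toBilin_injective (A B C : FDRep ℂ G) : Function.Injective (FDRep.toBilin A B C) :=
  (TensorProduct.lift.equiv (.id ℂ) A B C).symm.injective.comp (FDRep.toLin_injective _ _)

lemma FDRep.toBilin_rho {A B C : FDRep ℂ G} (f : A ⊗ B ⟶ C) (g : G) (a : A) (b : B) :
    FDRep.toBilin A B C f (A.ρ g a) (B.ρ g b) = C.ρ g (FDRep.toBilin A B C f a b) :=
  FDRep.toLin_rho f g (a ⊗ₜ[ℂ] b)

end FDRep

/-- For `q ≥ 3` a prime power, if `σ` is an irreducible complex representation of `GL₂(q)`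
of dimension `q + 1` and `τ` one of dimension `q - 1`, then `σ ⊗ τ` is multiplicity free
and contains no one-dimensional subrepresentation. -/
theorem tensor_q_add_one_q_sub_one_multFree (q : ℕ) (hq : 3 ≤ q)
    (F : Type) [Field F] [Fintype F] (hF : Fintype.card F = q)
    (σ τ : FDRep ℂ (Matrix.GeneralLinearGroup (Fin 2) F)) [Simple σ] [Simple τ]
    (hσ : finrank ℂ σ = q + 1) (hτ : finrank ℂ τ = q - 1) :
    (∀ χ : FDRep ℂ (Matrix.GeneralLinearGroup (Fin 2) F), Simple χ →
        finrank ℂ (χ ⟶ σ ⊗ τ) ≤ 1) ∧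
      (∀ χ : FDRep ℂ (Matrix.GeneralLinearGroup (Fin 2) F), finrank ℂ χ = 1 →
        finrank ℂ (χ ⟶ σ ⊗ τ) = 0) := by
  subst hF
  have hirrσ := FDRep.noInvariant σ
  have hirrτ := FDRep.noInvariant τ
  have hσ' : finrank ℂ σ.V = Fintype.card F + 1 := hσ
  have hτ' : finrank ℂ τ.V = Fintype.card F - 1 := hτ
  obtain ⟨v, hvU, hv0, hB⟩ := GLTwo.exists_borel_eigenvector hirrσ
    (GLTwo.whittaker_zero_ne_bot hirrσ (by omega))
  have hne := GLTwo.whittaker_ne_bot hirrτ (by omega)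
  have hbot := GLTwo.whittaker_zero_eq_bot hne (by omega)
  obtain ⟨w, hw, hw0⟩ := Submodule.exists_mem_ne_zero_of_ne_bot hne
  have key (χ : FDRep ℂ (Matrix.GeneralLinearGroup (Fin 2) F)) :
      finrank ℂ (χ ⟶ σ ⊗ τ) ≤ finrank ℂ (GLTwo.whittaker χ.ρ 1) := by
    rw [FDRep.finrank_hom_comm]
    let ev : (σ ⊗ τ ⟶ χ) →ₗ[ℂ] GLTwo.whittaker χ.ρ 1 :=
      LinearMap.codRestrict _
        ((LinearMap.applyₗ w) ∘ₗ (LinearMap.applyₗ v) ∘ₗ FDRep.toBilin σ τ χ) fun f x => by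
          have h := FDRep.toBilin_rho f (GLTwo.upperUnipotent x) v w
          rw [hvU x, hw x] at h
          simpa using h.symm
    refine LinearMap.finrank_le_finrank_of_injective (f := ev)
      ((injective_iff_map_eq_zero ev).2 fun f hf => ?_)
    have hf' : FDRep.toBilin σ τ χ f v w = 0 := congrArg Subtype.val hf
    apply FDRep.toBilin_injective
    rw [map_zero]
    exact GLTwo.bilinear_eq_zero hirrσ hirrτ hbot _ (FDRep.toBilin_rho f) hv0 hB hw hw0 hf'
  refine ⟨fun χ hχ => (key χ).trans
    (GLTwo.finrank_whittaker_le_one (FDRep.noInvariant χ) one_ne_zero), fun χ hχ => ?_⟩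
  have hχ' : finrank ℂ χ.V = 1 := hχ
  have h := key χ
  rw [GLTwo.whittaker_eq_bot_of_finrank_eq_one hq hχ', finrank_bot] at h
  omega
end
end

section
/- Let q ≥ 3 be a prime power, let σ be an irreducible complex representation of GL₂(q) with dim σ = q, and let τ be an irreducible complex representation of GL₂(q) with dim τ = q − 1. Then the tensor product σ ⊗ τ is multiplicity free and contains no one-dimensional subrepresentation. -/
open CategoryTheory Module MonoidalCategory

noncomputable section
open Matrix

namespace Representation

lemma IsIrreducible.of_simple {G : Type} [Group G] (V : FDRep ℂ G) [Simple V] :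
    IsIrreducible V.ρ := by
  have hnt : Nontrivial V := by
    by_contra h
    rw [not_nontrivial_iff_subsingleton] at h
    apply id_nonzero V
    ext x
    exact Subsingleton.elim (α := V) _ _
  have : Nontrivial (Subrepresentation V.ρ) := by
    refine ⟨⟨⊥, ⊤, fun h => ?_⟩⟩
    have := congrArg Subrepresentation.toSubmodule h
    exact bot_ne_top (α := Submodule ℂ V) this
  refine ⟨fun p => ?_⟩
  let i : FDRep.of p.toRepresentation ⟶ V :=
    ⟨FGModuleCat.ofHom p.toSubmodule.subtype, fun g => by ext x; rfl⟩
  have hi : Function.Injective (fun x : p.toSubmodule => (x : V)) := Subtype.val_injective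
  by_cases h0 : i = 0
  · left
    have : ∀ x : p.toSubmodule, (x : V) = 0 := fun x => 
      congrArg (fun f : FDRep.of p.toRepresentation ⟶ V => f.hom.hom.hom x) h0
    apply Subrepresentation.toSubmodule_injective
    exact (Submodule.eq_bot_iff _).2 fun x hx => this ⟨x, hx⟩
  · right
    have : Mono i := by
      apply (forget₂ (FDRep ℂ G) (FGModuleCat ℂ) ⋙ forget (FGModuleCat ℂ)).mono_of_mono_map
      rw [CategoryTheory.mono_iff_injective]
      exact hi
    have : IsIso i := isIso_of_mono_of_nonzero h0
    apply Subrepresentation.toSubmodule_injective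
    refine (Submodule.eq_top_iff'.2 fun x => ?_)
    have hs : i.hom.hom.hom ((inv i).hom.hom.hom x) = x :=
      congrArg (fun f : V ⟶ V => f.hom.hom.hom x) (IsIso.inv_hom_id i)
    rw [← hs]
    exact Subtype.prop (p := (· ∈ p.toSubmodule)) _

variable {F : Type} [Field F]

/-- The upper triangular unipotent matrix with upper right entry `s`. -/
def unipotent (s : F) : GL (Fin 2) F :=
  GeneralLinearGroup.mkOfDetNeZero !![1, s; 0, 1] (by simp [det_fin_two])

/-- The diagonal matrix with entries `t` and `1`. -/
def torus {t : F} (ht : t ≠ 0) : GL (Fin 2) F :=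
  GeneralLinearGroup.mkOfDetNeZero !![t, 0; 0, 1] (by simpa [det_fin_two])

lemma coe_unipotent (s : F) : (unipotent s : Matrix (Fin 2) (Fin 2) F) = !![1, s; 0, 1] := rfl

lemma coe_torus {t : F} (ht : t ≠ 0) :
    (torus ht : Matrix (Fin 2) (Fin 2) F) = !![t, 0; 0, 1] := rfl

/-- The anti-involution of `GL₂` swapping the two diagonal entries. -/
def swapDiag (x : GL (Fin 2) F) : GL (Fin 2) F :=
  GeneralLinearGroup.mkOfDetNeZero !![x 1 1, x 0 1; x 1 0, x 0 0] (by
    have h := x.det_ne_zero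
    rw [det_fin_two] at h
    simpa [det_fin_two, mul_comm] using h)

lemma coe_swapDiag (x : GL (Fin 2) F) :
    (swapDiag x : Matrix (Fin 2) (Fin 2) F) = !![x 1 1, x 0 1; x 1 0, x 0 0] := rfl

lemma swapDiag_mul (x y : GL (Fin 2) F) : swapDiag (x * y) = swapDiag y * swapDiag x := by
  ext i j
  fin_cases i <;> fin_cases j <;>
    simp [coe_swapDiag, Matrix.mul_apply, Fin.sum_univ_two] <;> ring

lemma swapDiag_unipotent (s : F) : swapDiag (unipotent s) = unipotent s := by
  ext i j
  fin_cases i <;> fin_cases j <;> simp [coe_swapDiag, coe_unipotent]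

lemma unipotent_zero : unipotent (0 : F) = 1 := by
  ext i j
  fin_cases i <;> fin_cases j <;> simp [coe_unipotent]

lemma unipotent_add (s t : F) : unipotent (s + t) = unipotent s * unipotent t := by
  ext i j
  fin_cases i <;> fin_cases j <;>
    simp [coe_unipotent, Matrix.mul_apply, Fin.sum_univ_two, add_comm]

lemma torus_mul_unipotent {t : F} (ht : t ≠ 0) (s : F) :
    torus ht * unipotent s = unipotent (t * s) * torus ht := by
  ext i j
  fin_cases i <;> fin_cases j <;>
    simp [coe_unipotent, coe_torus, Matrix.mul_apply, Fin.sum_univ_two]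

lemma mul_unipotent_of_lower_eq_zero {x : GL (Fin 2) F} (hx : x 1 0 = 0) (s : F) :
    x * unipotent (x 1 1 * s) = unipotent (x 0 0 * s) * x := by
  ext i j
  fin_cases i <;> fin_cases j <;>
    simp [coe_unipotent, Matrix.mul_apply, Fin.sum_univ_two, hx]
  ring

lemma swapDiag_of_lower_ne_zero {x : GL (Fin 2) F} (hx : x 1 0 ≠ 0) :
    swapDiag x = unipotent ((x 1 1 - x 0 0) / x 1 0) * x *
      unipotent (-((x 1 1 - x 0 0) / x 1 0)) := by
  ext i j
  fin_cases i <;> fin_cases j <;>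
    simp [coe_unipotent, coe_swapDiag, Matrix.mul_apply, Fin.sum_univ_two,
      vecMul_eq_sum] <;> field_simp <;> ring

/-- The matrix exchanging the two coordinates. -/
def weyl : GL (Fin 2) F :=
  GeneralLinearGroup.mkOfDetNeZero !![0, 1; 1, 0] (by simp [det_fin_two])

lemma coe_weyl : ((weyl : GL (Fin 2) F) : Matrix (Fin 2) (Fin 2) F) = !![0, 1; 1, 0] := rfl

lemma weyl_mul_weyl : (weyl : GL (Fin 2) F) * weyl = 1 := by
  ext i j
  fin_cases i <;> fin_cases j <;> simp [coe_weyl, Matrix.mul_apply, Fin.sum_univ_two]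

lemma eq_unipotent_mul_of_lower_ne_zero {x : GL (Fin 2) F} (hx : x.det = 1) (hc : x 1 0 ≠ 0) :
    x = unipotent ((x 0 0 - 1) / x 1 0) * (weyl * unipotent (x 1 0) * weyl) *
      unipotent ((x 1 1 - 1) / x 1 0) := by
  have h : x 0 0 * x 1 1 - x 0 1 * x 1 0 = 1 := by
    rw [← det_fin_two]
    exact congrArg Units.val hx
  ext i j
  fin_cases i <;> fin_cases j <;>
    simp [coe_unipotent, coe_weyl, Matrix.mul_apply, Fin.sum_univ_two] <;> field_simp <;>
    first | ring1 | linear_combination -h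

/-- A homomorphism on `GL₂` that kills the upper unipotent matrices kills `SL₂`. -/
lemma map_eq_one_of_det_eq_one {M : Type*} [Monoid M] (f : GL (Fin 2) F →* M)
    (hf : ∀ s, f (unipotent s) = 1) {x : GL (Fin 2) F} (hx : x.det = 1) : f x = 1 := by
  have hw (s : F) : f (weyl * unipotent s * weyl) = 1 := by
    rw [map_mul, map_mul, hf, mul_one, ← map_mul, weyl_mul_weyl, map_one]
  have hlow {y : GL (Fin 2) F} (hy : y.det = 1) (hc : y 1 0 ≠ 0) : f y = 1 := by
    rw [eq_unipotent_mul_of_lower_ne_zero hy hc, map_mul, map_mul, hw, hf, hf, one_mul, one_mul]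
  by_cases hc : x 1 0 = 0
  · have hdet : (weyl * unipotent (1 : F) * weyl).det = 1 := by
      ext
      simp [coe_weyl, coe_unipotent, det_fin_two]
    have ha : x 0 0 ≠ 0 := by
      intro ha
      apply x.det_ne_zero
      rw [det_fin_two, ha, hc]
      ring
    have h := hlow (y := weyl * unipotent 1 * weyl * x) (by rw [map_mul, hdet, hx, one_mul])
      (by simpa [coe_weyl, coe_unipotent, Matrix.mul_apply, Fin.sum_univ_two, hc] using ha)
    rwa [map_mul, hw, one_mul] at h
  · exact hlow hx hc

variable [Fintype F]
variable {V : Type*} [AddCommGroup V] [Module ℂ V]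

/-- The projection onto the isotypic part of the character `s ↦ ψ (a * s)`
of the unipotent subgroup. -/
def charProj (ψ : AddChar F ℂ) (ρ : Representation ℂ (GL (Fin 2) F) V) (a : F) : End ℂ V :=
  (Fintype.card F : ℂ)⁻¹ • ∑ s, ψ (-(a * s)) • ρ (unipotent s)

variable (ψ : AddChar F ℂ) (ρ : Representation ℂ (GL (Fin 2) F) V)

lemma unipotent_mul_charProj (a s : F) :
    ρ (unipotent s) * charProj ψ ρ a = ψ (a * s) • charProj ψ ρ a := by
  rw [charProj, smul_comm]
  simp only [mul_smul_comm, Finset.mul_sum, ← map_mul,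
    ← unipotent_add, Finset.smul_sum (r := ψ (a * s)), smul_smul, ← AddChar.map_add_eq_mul]
  rw [← Equiv.sum_comp (Equiv.addLeft s) (fun t => ψ (a * s + -(a * t)) • ρ (unipotent t))]
  simp [mul_add]

lemma charProj_mul_unipotent (a s : F) :
    charProj ψ ρ a * ρ (unipotent s) = ψ (a * s) • charProj ψ ρ a := by
  rw [← unipotent_mul_charProj]
  simp only [charProj, mul_smul_comm, smul_mul_assoc, Finset.mul_sum, Finset.sum_mul, ← map_mul,
    ← unipotent_add, add_comm]

variable {ψ}

lemma charProj_mul_charProj (hψ : ψ.IsPrimitive) [DecidableEq F] (a b : F) :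
    charProj ψ ρ b * charProj ψ ρ a = if a = b then charProj ψ ρ a else 0 := by
  have hq : (Fintype.card F : ℂ) ≠ 0 := by simp
  conv_lhs => rw [charProj]
  simp only [smul_mul_assoc, Finset.sum_mul, unipotent_mul_charProj, smul_smul,
    ← AddChar.map_add_eq_mul, ← Finset.sum_smul]
  have := AddChar.sum_mulShift (a - b) hψ
  simp only [sub_eq_zero] at this
  have h2 : ∑ s, ψ (-(b * s) + a * s) = ∑ s, ψ (s * (a - b)) :=
    Finset.sum_congr rfl fun s _ => by ring_nf
  rw [h2, this]
  split_ifs with h <;> simp [hq]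

lemma sum_charProj (hψ : ψ.IsPrimitive) : ∑ a, charProj ψ ρ a = 1 := by
  classical
  have hq : (Fintype.card F : ℂ) ≠ 0 := by simp
  simp only [charProj, ← Finset.smul_sum]
  rw [Finset.sum_comm]
  simp only [← Finset.sum_smul]
  have (s : F) : ∑ a, ψ (-(a * s)) = if s = 0 then (Fintype.card F : ℂ) else 0 := by
    simpa using AddChar.sum_mulShift (-s) hψ
  simp [this, unipotent_zero, hq]

variable (ψ) in
lemma torus_mul_charProj {t : F} (ht : t ≠ 0) (a : F) :
    ρ (torus ht) * charProj ψ ρ (a * t) = charProj ψ ρ a * ρ (torus ht) := by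
  simp only [charProj, mul_smul_comm, smul_mul_assoc, Finset.mul_sum, Finset.sum_mul, ← map_mul,
    torus_mul_unipotent]
  rw [← Equiv.sum_comp (Equiv.mulLeft₀ t ht)
    (fun s => ψ (-(a * s)) • ρ (unipotent s * torus ht))]
  simp [mul_assoc]

lemma charProj_swapDiag (hψ : ψ.IsPrimitive) (x : GL (Fin 2) F) :
    charProj ψ ρ 1 * ρ (swapDiag x) * charProj ψ ρ 1 =
      charProj ψ ρ 1 * ρ x * charProj ψ ρ 1 := by
  by_cases hx : x 1 0 = 0
  · by_cases had : x 0 0 = x 1 1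
    · congr 3
      ext i j
      fin_cases i <;> fin_cases j <;> simp [coe_swapDiag, had]
    · have key : ∀ y : GL (Fin 2) F, y 1 0 = 0 → y 0 0 ≠ y 1 1 →
          charProj ψ ρ 1 * ρ y * charProj ψ ρ 1 = 0 := by
        intro y hy hne
        obtain ⟨s, hs⟩ : ∃ s, ψ ((y 0 0 - y 1 1) * s) ≠ 1 := by
          have := hψ (sub_ne_zero.2 hne)
          contrapose! this
          ext s
          simpa using this s
        have h1 : charProj ψ ρ 1 * ρ y * (ρ (unipotent (y 1 1 * s)) * charProj ψ ρ 1) =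
            charProj ψ ρ 1 * ρ (unipotent (y 0 0 * s)) * ρ y * charProj ψ ρ 1 := by
          rw [mul_assoc _ _ (ρ y), ← map_mul, ← mul_unipotent_of_lower_eq_zero hy, map_mul]
          simp only [mul_assoc]
        rw [unipotent_mul_charProj, charProj_mul_unipotent] at h1
        simp only [one_mul, mul_smul_comm, smul_mul_assoc] at h1
        have h2 : ψ (y 1 1 * s) ≠ ψ (y 0 0 * s) := by
          intro h
          apply hs
          rw [sub_mul, AddChar.map_sub_eq_div, h, div_self]
          exact ψ.val_isUnit _ |>.ne_zero
        rw [← sub_eq_zero, ← sub_smul] at h1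
        exact (smul_eq_zero.1 h1).resolve_left (sub_ne_zero.2 h2)
      rw [key x hx had, key (swapDiag x) (by simpa [coe_swapDiag] using hx)
        (by simpa [coe_swapDiag] using Ne.symm had)]
  · rw [swapDiag_of_lower_ne_zero hx]
    generalize (x 1 1 - x 0 0) / x 1 0 = s
    have : charProj ψ ρ 1 * ρ (unipotent s * x * unipotent (-s)) * charProj ψ ρ 1 =
        (charProj ψ ρ 1 * ρ (unipotent s)) * ρ x * (ρ (unipotent (-s)) * charProj ψ ρ 1) := by
      simp only [map_mul, mul_assoc]
    rw [this, charProj_mul_unipotent, unipotent_mul_charProj]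
    simp [smul_smul, ← AddChar.map_add_eq_mul]

lemma charProj_compression_commute (hψ : ψ.IsPrimitive) (x y : GL (Fin 2) F) :
    Commute (charProj ψ ρ 1 * ρ x * charProj ψ ρ 1) (charProj ψ ρ 1 * ρ y * charProj ψ ρ 1) := by
  classical
  set P := charProj ψ ρ 1 with hP
  have hPP : P * P = P := by simpa using charProj_mul_charProj ρ hψ 1 1
  have expand (x y : GL (Fin 2) F) : P * ρ x * P * ρ y * P = (Fintype.card F : ℂ)⁻¹ •
      ∑ s, ψ (-(1 * s)) • (P * ρ (x * unipotent s * y) * P) := by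
    conv_lhs => enter [1, 1, 2]; rw [hP, charProj]
    simp only [mul_smul_comm, smul_mul_assoc, Finset.mul_sum, Finset.sum_mul, map_mul, mul_assoc]
  have expand' (x y : GL (Fin 2) F) : P * ρ x * P * ρ y * P = P * ρ x * P * (P * ρ y * P) := by
    rw [← mul_assoc, ← mul_assoc, mul_assoc (P * ρ x) P P, hPP]
  have hxy : P * ρ x * P * ρ y * P = P * ρ y * P * ρ x * P := by
    calc _ = P * ρ (swapDiag y) * P * ρ (swapDiag x) * P := by
          rw [expand, expand]
          congr 1
          refine Finset.sum_congr rfl fun s _ => ?_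
          rw [hP, ← charProj_swapDiag ρ hψ, swapDiag_mul, swapDiag_mul, swapDiag_unipotent,
            mul_assoc (swapDiag y)]
      _ = P * ρ y * P * ρ x * P := by
          rw [expand', expand', hP, charProj_swapDiag ρ hψ, charProj_swapDiag ρ hψ]
  rw [commute_iff_eq, ← expand', hxy, expand']

section Irreducible

variable {G W : Type*} [Group G] [AddCommGroup W] [Module ℂ W] {π : Representation ℂ G W}

lemma IsIrreducible.eq_top_of_forall_mem (hπ : π.IsIrreducible) {v : W} (hv : v ≠ 0)
    {p : Submodule ℂ W} (h : ∀ g, π g v ∈ p) : p = ⊤ := by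
  let S : Subrepresentation π := ⟨Submodule.span ℂ (Set.range fun g => π g v), fun g x hx => by
    induction hx using Submodule.span_induction with
    | mem x hx =>
      obtain ⟨k, rfl⟩ := hx
      exact Submodule.subset_span ⟨g * k, by simp⟩
    | zero => rw [map_zero]; exact zero_mem _
    | add x y _ _ hx hy => rw [map_add]; exact add_mem hx hy
    | smul c x _ hx => rw [map_smul]; exact Submodule.smul_mem _ c hx⟩
  have hvS : v ∈ S.toSubmodule := Submodule.subset_span ⟨1, by simp⟩
  have hS : S.toSubmodule = ⊤ := by
    rcases hπ.eq_bot_or_eq_top S with h | h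
    · rw [h] at hvS
      exact (hv ((Submodule.mem_bot ℂ).1 hvS)).elim
    · rw [h]; rfl
  rw [eq_top_iff, ← hS]
  exact Submodule.span_le.2 (by rintro _ ⟨g, rfl⟩; exact h g)

/-- If the compressions of an irreducible representation to the image of an idempotent commute,
then the image is at most one-dimensional. -/
lemma IsIrreducible.finrank_range_le_one [FiniteDimensional ℂ W] (hπ : π.IsIrreducible)
    {e : End ℂ W} (he : e * e = e)
    (hc : ∀ x y, Commute (e * π x * e) (e * π y * e)) :
    finrank ℂ (LinearMap.range e) ≤ 1 := by
  by_cases he0 : e = 0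
  · rw [he0, LinearMap.range_zero, finrank_bot]
    exact zero_le_one
  have hee (w : W) : e (e w) = e w := LinearMap.congr_fun he w
  have hbot : LinearMap.range e ≠ ⊥ := by rwa [Ne, LinearMap.range_eq_bot]
  have hmem {w : W} (hw : w ∈ LinearMap.range e) : e w = w := by
    obtain ⟨w, rfl⟩ := hw
    exact hee w
  have : Nontrivial (LinearMap.range e) :=
    Submodule.nontrivial_iff_ne_bot.2 hbot
  have hscalar (x : G) : ∃ c : ℂ, ∀ w, e (π x (e w)) = c • e w := by
    obtain ⟨c, hcx⟩ := Module.End.exists_eigenvalue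
      ((e * π x * e).restrict (p := LinearMap.range e) (q := LinearMap.range e)
        fun w _ => ⟨π x (e w), rfl⟩)
    obtain ⟨⟨w₀, hw₀⟩, hw⟩ := hcx.exists_hasEigenvector
    have hne : w₀ ≠ 0 := fun h => hw.2 (Subtype.ext h)
    have hxw : e (π x (e w₀)) = c • w₀ := congrArg Subtype.val hw.apply_eq_smul
    have htop := hπ.eq_top_of_forall_mem hne
      (p := LinearMap.ker (e * π x * e - c • e)) (fun y => by
        have hcomm := LinearMap.congr_fun (hc x y) w₀
        simp only [Module.End.mul_apply, hee] at hcomm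
        rw [hxw, map_smul, map_smul] at hcomm
        simp [← hcomm, hmem hw₀])
    refine ⟨c, fun w => ?_⟩
    have : w ∈ LinearMap.ker (e * π x * e - c • e) := htop ▸ Submodule.mem_top
    simpa [sub_eq_zero] using this
  obtain ⟨⟨w₀, hw₀⟩, hne⟩ := exists_ne (0 : LinearMap.range e)
  have hne : w₀ ≠ 0 := fun h => hne (Subtype.ext h)
  have htop := hπ.eq_top_of_forall_mem hne
    (p := (Submodule.span ℂ {w₀}).comap e) (fun y => by
      obtain ⟨c, h⟩ := hscalar y
      have := h w₀
      rw [hmem hw₀] at this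
      rw [Submodule.mem_comap, this]
      exact Submodule.smul_mem _ _ (Submodule.mem_span_singleton_self _))
  refine finrank_le_one ⟨w₀, hw₀⟩ ?_
  rintro ⟨w, hw⟩
  have h : w ∈ (Submodule.span ℂ {w₀}).comap e := htop ▸ Submodule.mem_top
  rw [Submodule.mem_comap, hmem hw, Submodule.mem_span_singleton] at h
  obtain ⟨c, hc⟩ := h
  exact ⟨c, Subtype.ext hc⟩

end Irreducible

variable {ρ}

/-- Uniqueness of Whittaker vectors. -/
lemma IsIrreducible.finrank_range_charProj_le_one [FiniteDimensional ℂ V]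
    (hρ : ρ.IsIrreducible) (hψ : ψ.IsPrimitive) :
    finrank ℂ (LinearMap.range (charProj ψ ρ 1)) ≤ 1 := by
  classical
  exact hρ.finrank_range_le_one (by simpa using charProj_mul_charProj ρ hψ 1 1)
    (charProj_compression_commute ρ hψ)

variable (ψ ρ) in
lemma charProj_eq_conj {t : F} (ht : t ≠ 0) :
    charProj ψ ρ t = ρ (torus ht)⁻¹ * charProj ψ ρ 1 * ρ (torus ht) := by
  rw [mul_assoc, ← torus_mul_charProj, ← mul_assoc, ← map_mul]
  simp

lemma IsIrreducible.finrank_le_one_of_charProj_eq_zero [FiniteDimensional ℂ V]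
    (hρ : ρ.IsIrreducible) (hψ : ψ.IsPrimitive) (h : charProj ψ ρ 1 = 0) :
    finrank ℂ V ≤ 1 := by
  have h0 : charProj ψ ρ 0 = 1 := by
    rw [← sum_charProj ρ hψ, Finset.sum_eq_single 0 (fun t _ ht => by
      rw [charProj_eq_conj ψ ρ ht, h]; simp) (by simp)]
  have hu (s : F) : ρ (unipotent s) = 1 := by
    have := unipotent_mul_charProj ψ ρ 0 s
    simpa [h0] using this
  have hcomm (x y : GL (Fin 2) F) : Commute (ρ x) (ρ y) := by
    have := map_eq_one_of_det_eq_one ρ hu (x := x * y * (y * x)⁻¹)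
      (by simp only [map_mul, map_inv, mul_comm x.det]; exact mul_inv_cancel _)
    rw [commute_iff_eq, ← map_mul, ← map_mul]
    conv_lhs => rw [← inv_mul_cancel_right (x * y) (y * x), map_mul, this, one_mul]
  have := hρ.finrank_range_le_one (e := 1) (mul_one _) (by simpa using hcomm)
  rwa [Module.End.one_eq_id, LinearMap.range_id, finrank_top] at this

variable (ρ) in
lemma finrank_eq_add_mul [FiniteDimensional ℂ V] (hψ : ψ.IsPrimitive) :
    finrank ℂ V = finrank ℂ (LinearMap.range (charProj ψ ρ 0)) +
      (Fintype.card F - 1) * finrank ℂ (LinearMap.range (charProj ψ ρ 1)) := by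
  classical
  have htr (a : F) : LinearMap.trace ℂ V (charProj ψ ρ a) =
      finrank ℂ (LinearMap.range (charProj ψ ρ a)) := by
    have : IsIdempotentElem (charProj ψ ρ a) :=
      (charProj_mul_charProj ρ hψ a a).trans (if_pos rfl)
    exact (LinearMap.IsIdempotentElem.isProj_range _ this).trace
  have hconj {t : F} (ht : t ≠ 0) : LinearMap.trace ℂ V (charProj ψ ρ t) =
      LinearMap.trace ℂ V (charProj ψ ρ 1) := by
    rw [charProj_eq_conj ψ ρ ht, LinearMap.trace_mul_comm, ← mul_assoc, ← map_mul]
    simp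
  have h := congrArg (LinearMap.trace ℂ V) (sum_charProj ρ hψ)
  rw [map_sum, LinearMap.trace_one, ← Finset.add_sum_erase _ _ (Finset.mem_univ 0),
    Finset.sum_congr rfl (fun t ht => hconj (Finset.ne_of_mem_erase ht)), Finset.sum_const,
    Finset.card_erase_of_mem (Finset.mem_univ _), Finset.card_univ, htr, htr, nsmul_eq_mul] at h
  exact_mod_cast h.symm

lemma charProj_one_eq_zero_of_finrank_eq_one [FiniteDimensional ℂ V] (hF : 3 ≤ Fintype.card F)
    (hψ : ψ.IsPrimitive) (h : finrank ℂ V = 1) : charProj ψ ρ 1 = 0 := by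
  have h1 := finrank_eq_add_mul ρ hψ
  rw [← LinearMap.range_eq_bot, ← Submodule.finrank_eq_zero (R := ℂ)]
  by_contra hne
  have h2 := Nat.le_mul_of_pos_right (Fintype.card F - 1) (Nat.pos_of_ne_zero hne)
  omega

lemma IsIrreducible.finrank_range_charProj_one [FiniteDimensional ℂ V]
    (hρ : ρ.IsIrreducible) (hψ : ψ.IsPrimitive) (h : 2 ≤ finrank ℂ V) :
    finrank ℂ (LinearMap.range (charProj ψ ρ 1)) = 1 := by
  refine le_antisymm (hρ.finrank_range_charProj_le_one hψ) (Nat.one_le_iff_ne_zero.2 fun h0 => ?_)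
  have := hρ.finrank_le_one_of_charProj_eq_zero hψ
    (LinearMap.range_eq_bot.1 (Submodule.finrank_eq_zero.1 h0))
  omega

section Tensor

open scoped _root_.TensorProduct

variable {V' W : Type*} [AddCommGroup V'] [Module ℂ V'] [AddCommGroup W] [Module ℂ W]
  {σ : Representation ℂ (GL (Fin 2) F) V} {τ : Representation ℂ (GL (Fin 2) F) V'}
  {π : Representation ℂ (GL (Fin 2) F) W}

/-- An equivariant map into a tensor product is determined by its component in the product of
the unipotent invariants of the left factor and a Whittaker eigenspace of the right factor. -/
lemma IsIrreducible.eq_zero_of_map_charProj_comp_eq_zero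
    (hσ : σ.IsIrreducible) (hψ : ψ.IsPrimitive)
    (hσ0 : charProj ψ σ 0 ≠ 0) (hτ0 : charProj ψ τ 0 = 0) {f : W →ₗ[ℂ] V ⊗[ℂ] V'}
    (hf : ∀ g, f ∘ₗ π g = _root_.TensorProduct.map (σ g) (τ g) ∘ₗ f)
    (h : _root_.TensorProduct.map (charProj ψ σ 0) (charProj ψ τ 1) ∘ₗ f = 0) : f = 0 := by
  have h1 (t : F) (ht : t ≠ 0) :
      _root_.TensorProduct.map (charProj ψ σ 0) (charProj ψ τ t) ∘ₗ f = 0 := by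
    have hs : charProj ψ σ 0 = σ (torus ht)⁻¹ * charProj ψ σ 0 * σ (torus ht) := by
      rw [mul_assoc, ← torus_mul_charProj, ← mul_assoc, ← map_mul]
      simp
    rw [hs, charProj_eq_conj ψ τ ht, _root_.TensorProduct.map_mul, _root_.TensorProduct.map_mul,
      Module.End.mul_eq_comp, Module.End.mul_eq_comp, LinearMap.comp_assoc, ← hf,
      LinearMap.comp_assoc, ← LinearMap.comp_assoc _ f, h]
    simp
  have h2 : LinearMap.rTensor V' (charProj ψ σ 0) ∘ₗ f = 0 := by
    rw [LinearMap.rTensor, ← Module.End.one_eq_id, ← sum_charProj τ hψ,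
      ← _root_.TensorProduct.mapBilinear_apply, map_sum]
    ext w
    rw [LinearMap.comp_apply, LinearMap.sum_apply]
    refine Finset.sum_eq_zero fun t _ => ?_
    rw [_root_.TensorProduct.mapBilinear_apply]
    by_cases ht : t = 0
    · simp [ht, hτ0]
    · exact LinearMap.congr_fun (h1 t ht) w
  have h3 (g : GL (Fin 2) F) : LinearMap.rTensor V' (charProj ψ σ 0 * σ g) ∘ₗ f = 0 := by
    have : LinearMap.rTensor V' (charProj ψ σ 0 * σ g) = LinearMap.lTensor V (τ g⁻¹) *
        LinearMap.rTensor V' (charProj ψ σ 0) * _root_.TensorProduct.map (σ g) (τ g) := by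
      simp only [LinearMap.rTensor, LinearMap.lTensor, ← _root_.TensorProduct.map_mul,
        ← Module.End.one_eq_id, one_mul, mul_one, ← map_mul]
      simp
    rw [this, Module.End.mul_eq_comp, Module.End.mul_eq_comp, LinearMap.comp_assoc, ← hf,
      LinearMap.comp_assoc, ← LinearMap.comp_assoc _ f, h2]
    simp
  have hker {v : V} (hv : ∀ g, charProj ψ σ 0 (σ g v) = 0) : v = 0 := by
    by_contra hne
    have := hσ.eq_top_of_forall_mem hne (p := LinearMap.ker (charProj ψ σ 0)) hv
    exact hσ0 (LinearMap.ker_eq_top.1 this)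
  classical
  ext w
  let b := Basis.ofVectorSpace ℂ V'
  apply (_root_.TensorProduct.equivFinsuppOfBasisRight b).injective
  rw [LinearMap.zero_apply, map_zero]
  ext i
  apply hker
  intro g
  have hcoord : ∀ y : V ⊗[ℂ] V', charProj ψ σ 0 (σ g (_root_.TensorProduct.equivFinsuppOfBasisRight b y i)) =
      _root_.TensorProduct.equivFinsuppOfBasisRight b (LinearMap.rTensor V' (charProj ψ σ 0 * σ g) y) i := by
    intro y
    induction y with
    | zero => simp
    | tmul v v' => simp
    | add y z hy hz => simp only [map_add, Finsupp.add_apply, hy, hz]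
  rw [hcoord, ← LinearMap.comp_apply, h3]
  simp

lemma map_charProj_comp_charProj {f : W →ₗ[ℂ] V ⊗[ℂ] V'}
    (hf : ∀ g, f ∘ₗ π g = _root_.TensorProduct.map (σ g) (τ g) ∘ₗ f) :
    _root_.TensorProduct.map (charProj ψ σ 0) (charProj ψ τ 1) ∘ₗ f ∘ₗ charProj ψ π 1 =
      _root_.TensorProduct.map (charProj ψ σ 0) (charProj ψ τ 1) ∘ₗ f := by
  have hq : (Fintype.card F : ℂ) ≠ 0 := by simp
  have h (s : F) : _root_.TensorProduct.map (charProj ψ σ 0) (charProj ψ τ 1) ∘ₗ f ∘ₗ π (unipotent s) =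
      ψ s • _root_.TensorProduct.map (charProj ψ σ 0) (charProj ψ τ 1) ∘ₗ f := by
    rw [hf, ← LinearMap.comp_assoc, ← _root_.TensorProduct.map_comp, ← Module.End.mul_eq_comp,
      ← Module.End.mul_eq_comp, charProj_mul_unipotent, charProj_mul_unipotent]
    simp [_root_.TensorProduct.map_smul_right, LinearMap.smul_comp]
  rw [charProj.eq_def ψ π]
  ext w
  have h' (s : F) := LinearMap.congr_fun (h s) w
  simp only [LinearMap.comp_apply, LinearMap.smul_apply] at h'
  simp only [LinearMap.comp_apply, LinearMap.smul_apply, LinearMap.sum_apply, map_smul, map_sum,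
    h', smul_smul, ← AddChar.map_add_eq_mul]
  simp [← Nat.cast_smul_eq_nsmul ℂ, smul_smul, hq]

end Tensor

/-- The multiplicity space of `χ` in `σ ⊗ τ` embeds into the maps from the Whittaker space of `χ`
to the product of the unipotent invariants of `σ` and the Whittaker space of `τ`. -/
lemma finrank_hom_tensor_le (hψ : ψ.IsPrimitive) (χ σ τ : FDRep ℂ (GL (Fin 2) F)) [Simple σ]
    (hσ0 : charProj ψ σ.ρ 0 ≠ 0) (hτ0 : charProj ψ τ.ρ 0 = 0) :
    finrank ℂ (χ ⟶ σ ⊗ τ) ≤ finrank ℂ (LinearMap.range (charProj ψ χ.ρ 1)) *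
      (finrank ℂ (LinearMap.range (charProj ψ σ.ρ 0)) *
        finrank ℂ (LinearMap.range (charProj ψ τ.ρ 1))) := by
  let P := _root_.TensorProduct.map (charProj ψ σ.ρ 0).rangeRestrict
    (charProj ψ τ.ρ 1).rangeRestrict
  let toMap (f : χ ⟶ σ ⊗ τ) : χ →ₗ[ℂ] _root_.TensorProduct ℂ σ τ := f.hom.hom.hom
  let L : (χ ⟶ σ ⊗ τ) →ₗ[ℂ] (LinearMap.range (charProj ψ χ.ρ 1) →ₗ[ℂ]
      _root_.TensorProduct ℂ (LinearMap.range (charProj ψ σ.ρ 0))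
        (LinearMap.range (charProj ψ τ.ρ 1))) :=
    { toFun f := P ∘ₗ toMap f ∘ₗ Submodule.subtype _
      map_add' f g := LinearMap.ext fun x => map_add P (toMap f x) (toMap g x)
      map_smul' c f := LinearMap.ext fun x => map_smul P c (toMap f x) }
  have hL : Function.Injective L := by
    refine (injective_iff_map_eq_zero L).2 fun f hf => ?_
    have hcomm (g : GL (Fin 2) F) :
        toMap f ∘ₗ χ.ρ g = _root_.TensorProduct.map (σ.ρ g) (τ.ρ g) ∘ₗ toMap f :=
      congrArg (fun f => f.hom.hom) (f.comm g)
    have hzero : _root_.TensorProduct.map (charProj ψ σ.ρ 0) (charProj ψ τ.ρ 1) ∘ₗ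
        toMap f = 0 := by
      have hP : _root_.TensorProduct.map (charProj ψ σ.ρ 0) (charProj ψ τ.ρ 1) =
          _root_.TensorProduct.map (Submodule.subtype _) (Submodule.subtype _) ∘ₗ P := by
        rw [← _root_.TensorProduct.map_comp, LinearMap.subtype_comp_codRestrict,
          LinearMap.subtype_comp_codRestrict]
      rw [← map_charProj_comp_charProj hcomm, hP]
      ext x
      have := LinearMap.congr_fun hf ⟨charProj ψ χ.ρ 1 x, x, rfl⟩
      exact (congrArg _ this).trans (map_zero _)
    have h0 : toMap f = 0 :=
      (IsIrreducible.of_simple σ).eq_zero_of_map_charProj_comp_eq_zero hψ hσ0 hτ0 hcomm hzero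
    ext x
    exact LinearMap.congr_fun h0 x
  calc _ ≤ _ := LinearMap.finrank_le_finrank_of_injective hL
    _ = _ := by rw [finrank_linearMap, finrank_tensorProduct]

end Representation

open Representation

/-- For `q ≥ 3` a prime power, if `σ` is an irreducible complex representation of `GL₂(q)`
of dimension `q` and `τ` one of dimension `q - 1`, then `σ ⊗ τ` is multiplicity free
and contains no one-dimensional subrepresentation. -/
theorem tensor_q_q_sub_one_multFree (q : ℕ) (hq : 3 ≤ q)
    (F : Type) [Field F] [Fintype F] (hF : Fintype.card F = q)
    (σ τ : FDRep ℂ (Matrix.GeneralLinearGroup (Fin 2) F)) [Simple σ] [Simple τ]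
    (hσ : finrank ℂ σ = q) (hτ : finrank ℂ τ = q - 1) :
    (∀ χ : FDRep ℂ (Matrix.GeneralLinearGroup (Fin 2) F), Simple χ →
        finrank ℂ (χ ⟶ σ ⊗ τ) ≤ 1) ∧
      (∀ χ : FDRep ℂ (Matrix.GeneralLinearGroup (Fin 2) F), finrank ℂ χ = 1 →
        finrank ℂ (χ ⟶ σ ⊗ τ) = 0) := by
  subst hF
  let ψ := AddChar.FiniteField.primitiveChar_to_Complex F
  have hψ : ψ.IsPrimitive := AddChar.FiniteField.primitiveChar_to_Complex_isPrimitive F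
  have hσi := IsIrreducible.of_simple σ
  have hτi := IsIrreducible.of_simple τ
  have hσ1 := hσi.finrank_range_charProj_one hψ (by omega)
  have hτ1 := hτi.finrank_range_charProj_one hψ (by omega)
  have hσ0 := finrank_eq_add_mul σ.ρ hψ
  have hτ0 := finrank_eq_add_mul τ.ρ hψ
  rw [hσ1, mul_one, hσ] at hσ0
  rw [hτ1, mul_one, hτ] at hτ0
  have hσ0 : finrank ℂ (LinearMap.range (charProj ψ σ.ρ 0)) = 1 := by omega
  have hτ0 : finrank ℂ (LinearMap.range (charProj ψ τ.ρ 0)) = 0 := by omega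
  have hσ0' : charProj ψ σ.ρ 0 ≠ 0 := fun h => by
    rw [h, LinearMap.range_zero, finrank_bot] at hσ0
    omega
  have hτ0' : charProj ψ τ.ρ 0 = 0 :=
    LinearMap.range_eq_bot.1 (Submodule.finrank_eq_zero.1 hτ0)
  have key (χ : FDRep ℂ (GL (Fin 2) F)) :
      finrank ℂ (χ ⟶ σ ⊗ τ) ≤ finrank ℂ (LinearMap.range (charProj ψ χ.ρ 1)) := by
    simpa [hσ0, hτ1] using finrank_hom_tensor_le hψ χ σ τ hσ0' hτ0'
  refine ⟨fun χ hχ => (key χ).trans ?_, fun χ hχ => Nat.le_zero.1 ((key χ).trans_eq ?_)⟩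
  · exact (IsIrreducible.of_simple χ).finrank_range_charProj_le_one hψ
  · rw [charProj_one_eq_zero_of_finrank_eq_one hq hψ hχ, LinearMap.range_zero, finrank_bot]
end
end
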